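/- For every integer k ≥ 1 the set X_k is nonempty, countable, and contains no algebraic number (X_k ∩ ℚ̄ = ∅). Moreover, the sets X_1, X_2, X_3, … are pairwise disjoint. -/

import Mathlib

/-- Greedy partial sums: `gSigma τ n = σ_n(τ)`. -/
noncomputable def gSigma (τ : ℝ) : ℕ → ℝ
  | 0 => 0
  | n + 1 => gSigma τ n + (if gSigma τ n ≤ τ then (1 : ℝ) else -1) / (n + 1)

/-- Greedy signs: for `n ≥ 1`, `gSign τ n = s_n(τ)`. -/
noncomputable def gSign (τ : ℝ) (n : ℕ) : ℝ :=
  if gSigma τ (n - 1) ≤ τ then 1 else -1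

/-- Thue–Morse signs: `tmSign n = ε_n`. -/
noncomputable def tmSign (n : ℕ) : ℝ := (-1 : ℝ) ^ (Nat.digits 2 n).sum

/-- `fPer k` is the `2^k`-periodic function with `fPer k n = ε_n` for `0 ≤ n < 2^k`. -/
noncomputable def fPer (k n : ℕ) : ℝ := tmSign (n % 2 ^ k)

/-- The exceptional set `X_k`. -/
def Xset (k : ℕ) : Set ℝ :=
  {τ | ∃ N m : ℕ, m < 2 ^ k ∧ ∀ n : ℕ, 1 ≤ n → N ≤ n → gSign τ n = fPer k (n + m)}

section PartA
open Polynomial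

/-- one-variable zero estimate -/
lemma factor_one (g : ℂ → ℂ) (hg : Differentiable ℂ g) (s : ℂ) (e : ℕ)
    (h : ∀ i < e, iteratedDeriv i g s = 0) :
    ∃ k : ℂ → ℂ, Differentiable ℂ k ∧ ∀ z, g z = (z - s) ^ e * k z := by
  induction e with
  | zero => exact ⟨g, hg, by simp⟩
  | succ e ih =>
    obtain ⟨k, hk, hgk⟩ := ih (fun i hi => h i (by omega))
    have hord : ((e + 1 : ℕ) : ℕ∞) ≤ analyticOrderAt g s :=
      (natCast_le_analyticOrderAt_iff_iteratedDeriv_eq_zero (hg.analyticAt s)).2 h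
    have hks : k s = 0 := by
      by_contra hne
      have h1 : analyticOrderAt g s = (e : ℕ) := by
        rw [(hg.analyticAt s).analyticOrderAt_eq_natCast]
        exact ⟨k, hk.analyticAt s, hne, Filter.Eventually.of_forall (by simpa using hgk)⟩
      rw [h1] at hord
      have := Nat.cast_le.1 hord
      omega
    refine ⟨dslope k s, ?_, ?_⟩
    · have := (Complex.differentiableOn_dslope (s := Set.univ) (c := s) (f := k) (by simp)).2
        hk.differentiableOn
      exact differentiableOn_univ.1 this
    · intro z
      rw [hgk z, pow_succ, mul_assoc]
      congr 1
      have := sub_smul_dslope k s z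
      rw [hks, sub_zero] at this
      simpa using this.symm

lemma factor_many (g : ℂ → ℂ) (hg : Differentiable ℂ g) (S e : ℕ)
    (h : ∀ s < S, ∀ i < e, iteratedDeriv i g (s : ℂ) = 0) :
    ∃ k : ℂ → ℂ, Differentiable ℂ k ∧
      ∀ z, g z = (∏ s ∈ Finset.range S, (z - (s : ℂ)) ^ e) * k z := by
  induction S with
  | zero => exact ⟨g, hg, by simp⟩
  | succ S ih =>
    obtain ⟨k, hk, hgk⟩ := ih (fun s hs => h s (by omega))
    have hord : (e : ℕ∞) ≤ analyticOrderAt g (S : ℂ) :=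
      (natCast_le_analyticOrderAt_iff_iteratedDeriv_eq_zero (hg.analyticAt _)).2 (h S (by omega))
    have hgk' : g = (fun z => ∏ s ∈ Finset.range S, (z - (s : ℂ)) ^ e) * k := by
      funext z; simp [hgk z]
    have hp : Differentiable ℂ (fun z : ℂ => ∏ s ∈ Finset.range S, (z - (s : ℂ)) ^ e) := by
      fun_prop
    have hp0 : analyticOrderAt (fun z : ℂ => ∏ s ∈ Finset.range S, (z - (s : ℂ)) ^ e) (S : ℂ) = 0 := by
      rw [(hp.analyticAt _).analyticOrderAt_eq_zero]
      rw [Finset.prod_ne_zero_iff]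
      intro a ha
      apply pow_ne_zero
      rw [sub_ne_zero]
      have := Finset.mem_range.1 ha
      exact_mod_cast this.ne'
    rw [hgk', analyticOrderAt_mul (hp.analyticAt _) (hk.analyticAt _), hp0, zero_add] at hord
    obtain ⟨k', hk', h'⟩ := factor_one k hk S e
      ((natCast_le_analyticOrderAt_iff_iteratedDeriv_eq_zero (hk.analyticAt _)).1 hord)
    refine ⟨k', hk', fun z => ?_⟩
    rw [hgk z, h' z, Finset.prod_range_succ]; ring

lemma zero_estimate (g : ℂ → ℂ) (hg : Differentiable ℂ g) (S e : ℕ) (R M : ℝ)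
    (hS : 1 ≤ S) (hR : 4 * (S : ℝ) ≤ R)
    (h : ∀ s < S, ∀ i < e, iteratedDeriv i g (s : ℂ) = 0)
    (hM : ∀ z : ℂ, ‖z‖ ≤ R → ‖g z‖ ≤ M) (s : ℕ) (hs : s < S) :
    ‖iteratedDeriv e g (s : ℂ)‖ ≤ e.factorial * (M * (4 * S / R) ^ (S * e)) := by
  obtain ⟨k, hk, hgk⟩ := factor_many g hg S e h
  have hS' : (1 : ℝ) ≤ S := by exact_mod_cast hS
  have hRpos : 0 < R := by linarith
  have hM0 : 0 ≤ M := (norm_nonneg _).trans (hM 0 (by simpa using hRpos.le))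
  have hkb : ∀ z : ℂ, ‖z‖ ≤ R → ‖k z‖ ≤ M / (R / 2) ^ (S * e) := by
    intro z hz
    refine Complex.norm_le_of_forall_mem_frontier_norm_le (U := Metric.ball (0 : ℂ) R)
      Metric.isBounded_ball hk.diffContOnCl ?_ ?_
    · intro w hw
      rw [frontier_ball _ hRpos.ne'] at hw
      have hw' : ‖w‖ = R := by simpa using hw
      rw [le_div_iff₀ (by positivity)]
      have h1 : (R / 2) ^ (S * e) ≤ ‖∏ s ∈ Finset.range S, (w - (s : ℂ)) ^ e‖ := by
        rw [norm_prod, mul_comm S e, pow_mul]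
        have : ((R / 2) ^ e) ^ S = ∏ s ∈ Finset.range S, (R / 2) ^ e := by simp
        rw [this]
        apply Finset.prod_le_prod
        · intros; positivity
        · intro i hi
          rw [norm_pow]
          apply pow_le_pow_left₀ (by positivity)
          have := norm_sub_norm_le w (i : ℂ)
          have hi' : (i : ℝ) ≤ S := by exact_mod_cast (Finset.mem_range.1 hi).le
          rw [hw', Complex.norm_natCast] at this
          linarith
      calc ‖k w‖ * (R / 2) ^ (S * e) ≤ ‖k w‖ * ‖∏ s ∈ Finset.range S, (w - (s : ℂ)) ^ e‖ := by
            gcongr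
        _ = ‖g w‖ := by rw [hgk w, norm_mul, mul_comm]
        _ ≤ M := hM w hw'.le
    · rw [closure_ball _ hRpos.ne']; simpa using hz
  have hgb : ∀ z ∈ Metric.sphere (s : ℂ) 1, ‖g z‖ ≤ M * (4 * S / R) ^ (S * e) := by
    intro z hz
    have hz1 : ‖z - s‖ = 1 := by simpa [dist_eq_norm] using hz
    have hs1 : (s : ℝ) + 1 ≤ S := by exact_mod_cast hs
    have hz2 : ‖z‖ ≤ S := by
      have : ‖z‖ ≤ ‖z - s‖ + ‖(s : ℂ)‖ := by simpa using norm_add_le (z - s) (s : ℂ)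
      rw [hz1, Complex.norm_natCast] at this
      linarith
    rw [hgk z, norm_mul]
    have h1 : ‖∏ s ∈ Finset.range S, (z - (s : ℂ)) ^ e‖ ≤ (2 * S : ℝ) ^ (S * e) := by
      rw [norm_prod, mul_comm S e, pow_mul]
      have : (((2 * S : ℝ)) ^ e) ^ S = ∏ s ∈ Finset.range S, (2 * S : ℝ) ^ e := by simp
      rw [this]
      apply Finset.prod_le_prod
      · intros; positivity
      · intro i hi
        rw [norm_pow]
        apply pow_le_pow_left₀ (by positivity)
        have := norm_sub_le z (i : ℂ)
        have hi' : (i : ℝ) ≤ S := by exact_mod_cast (Finset.mem_range.1 hi).le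
        rw [Complex.norm_natCast] at this
        linarith
    calc _ ≤ (2 * S : ℝ) ^ (S * e) * (M / (R / 2) ^ (S * e)) := by
          gcongr; exact hkb z (by linarith)
      _ = M * (4 * S / R) ^ (S * e) := by
          rw [show (4 * S / R : ℝ) = (2 * S) / (R / 2) by field_simp; ring, div_pow (2 * (S : ℝ)), mul_div_left_comm]
  have := Complex.norm_iteratedDeriv_le_of_forall_mem_sphere_norm_le (c := (s : ℂ)) (R := 1) e
    one_pos (hg.diffContOnCl) hgb
  simpa [mul_div_assoc] using this

/-- expansion lemma -/
lemma expand_bound {A : Type*} [CommRing A] [Algebra ℂ A] {I J : Type*} [Fintype J]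
    (f : A →ₗ[ℂ] ℂ) (L : I → A) (Y : J → A) (c : I → J → ℂ) (hL : ∀ i, L i = ∑ j, c i j • Y j)
    (C M : ℝ) (hc : ∀ i, ∑ j, ‖c i j‖ ≤ C) (m : ℕ) (hC : 0 ≤ C) (hM0 : 0 ≤ M)
    (hM : ∀ s : List J, s.length = m → ‖f (s.map Y).prod‖ ≤ M) :
    ∀ l : List I, l.length = m → ‖f (l.map L).prod‖ ≤ C ^ m * M := by
  have key : ∀ (l : List I) (s : List J), l.length + s.length = m →
      ‖f ((l.map L).prod * (s.map Y).prod)‖ ≤ C ^ l.length * M := by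
    intro l
    induction l with
    | nil => intro s hs; simpa using hM s (by simpa using hs)
    | cons i l ih =>
      intro s hs
      have e1 : (((i :: l).map L).prod * (s.map Y).prod) =
          ∑ j, c i j • ((l.map L).prod * ((j :: s).map Y).prod) := by
        simp only [List.map_cons, List.prod_cons, hL i, Finset.sum_mul, smul_mul_assoc]
        refine Finset.sum_congr rfl fun j _ => ?_
        congr 1; ring
      rw [e1, map_sum]
      simp only [map_smul]
      have hb : ∀ j, ‖f ((l.map L).prod * ((j :: s).map Y).prod)‖ ≤ C ^ l.length * M :=
        fun j => ih (j :: s) (by simp at hs ⊢; omega)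
      have hCM : 0 ≤ C ^ l.length * M := by positivity
      calc _ ≤ ∑ j, ‖c i j • f ((l.map L).prod * ((j :: s).map Y).prod)‖ := norm_sum_le _ _
        _ ≤ ∑ j, ‖c i j‖ * (C ^ l.length * M) := by
            gcongr with j; rw [norm_smul]; gcongr; exact hb j
        _ = (∑ j, ‖c i j‖) * (C ^ l.length * M) := by rw [Finset.sum_mul]
        _ ≤ C * (C ^ l.length * M) := by gcongr; exact hc i
        _ = _ := by rw [List.length_cons, pow_succ]; ring
  intro l hl
  have := key l [] (by simpa using hl)
  simpa [hl] using this

/-- differential operator with constant coefficients acting on polynomials -/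
noncomputable def act {R : Type*} [CommRing R] (θ p : R[X]) : R[X] :=
  aeval (Polynomial.derivative : R[X] →ₗ[R] R[X]) θ p

section act
variable {R : Type*} [CommRing R]

lemma act_mul (θ φ p : R[X]) : act (θ * φ) p = act θ (act φ p) := by simp [act]
lemma act_one (p : R[X]) : act 1 p = p := by simp [act]
lemma act_add_left (θ φ p : R[X]) : act (θ + φ) p = act θ p + act φ p := by simp [act]
lemma act_add (θ p q : R[X]) : act θ (p + q) = act θ p + act θ q := by simp [act]
lemma act_C (c : R) (p : R[X]) : act (C c) p = C c * p := by simp [act, smul_eq_C_mul]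
lemma act_X (p : R[X]) : act X p = derivative p := by simp [act]
lemma act_zero (θ : R[X]) : act θ 0 = 0 := by simp [act]
lemma act_sum {ι : Type*} (s : Finset ι) (θ : R[X]) (f : ι → R[X]) :
    act θ (∑ i ∈ s, f i) = ∑ i ∈ s, act θ (f i) := by simp [act]
lemma act_C_mul (θ : R[X]) (c : R) (p : R[X]) : act θ (C c * p) = C c * act θ p := by
  simp [act, ← smul_eq_C_mul]
lemma act_map {R' : Type*} [CommRing R'] (f : R →+* R') (θ p : R[X]) :
    (act θ p).map f = act (θ.map f) (p.map f) := by
  induction θ using Polynomial.induction_on generalizing p with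
  | C a => simp [act_C]
  | add p q hp hq => simp [act_add_left, hp, hq]
  | monomial n a ih =>
    rw [pow_succ, ← mul_assoc, act_mul, act_X, ih]
    simp [act_mul, act_X, derivative_map]

/-- functional `θ ↦ (act θ p)(w)` is linear -/
lemma act_smul_left (c : R) (θ p : R[X]) : act (c • θ) p = C c * act θ p := by
  rw [smul_eq_C_mul, act_mul, act_C]

end act

/-- weighted ℓ¹ norm with degree bound `A` -/
noncomputable def wn (A : ℕ) (ρ : ℝ) (p : ℂ[X]) : ℝ := ∑ a ∈ Finset.range A, ‖p.coeff a‖ * ρ ^ a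

lemma wn_nonneg (A : ℕ) {ρ : ℝ} (hρ : 0 ≤ ρ) (p : ℂ[X]) : 0 ≤ wn A ρ p :=
  Finset.sum_nonneg fun _ _ => by positivity

lemma eval_le_wn (A : ℕ) {ρ : ℝ} (p : ℂ[X]) (hp : p ∈ degreeLT ℂ A) (z : ℂ)
    (hz : ‖z‖ ≤ ρ) : ‖p.eval z‖ ≤ wn A ρ p := by
  rw [eval_eq_sum_range' (n := A + 1)]
  · rw [Finset.sum_range_succ]
    have : p.coeff A = 0 := coeff_eq_zero_of_degree_lt (mem_degreeLT.1 hp)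
    rw [this, zero_mul, add_zero]
    refine (norm_sum_le _ _).trans (Finset.sum_le_sum fun a _ => ?_)
    rw [norm_mul, norm_pow]; gcongr
  · by_cases h0 : p = 0
    · simp [h0]
    · have := mem_degreeLT.1 hp
      rw [← natDegree_lt_iff_degree_lt h0] at this
      omega

lemma wn_add (A : ℕ) {ρ : ℝ} (hρ : 0 ≤ ρ) (p q : ℂ[X]) : wn A ρ (p + q) ≤ wn A ρ p + wn A ρ q := by
  unfold wn
  rw [← Finset.sum_add_distrib]
  refine Finset.sum_le_sum fun a _ => ?_
  rw [coeff_add, ← add_mul]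
  gcongr; exact norm_add_le _ _

lemma wn_C_mul (A : ℕ) {ρ : ℝ} (c : ℂ) (q : ℂ[X]) : wn A ρ (C c * q) = ‖c‖ * wn A ρ q := by
  unfold wn
  rw [Finset.mul_sum]
  refine Finset.sum_congr rfl fun a _ => ?_
  rw [coeff_C_mul, norm_mul, mul_assoc]

lemma wn_derivative (A : ℕ) {ρ : ℝ} (hρ : 1 ≤ ρ) (p : ℂ[X]) (hp : p ∈ degreeLT ℂ A) :
    wn A ρ (derivative p) ≤ A * wn A ρ p := by
  have hA : p.coeff A = 0 := coeff_eq_zero_of_degree_lt (mem_degreeLT.1 hp)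
  have h1 : wn A ρ (derivative p) ≤
      ∑ a ∈ Finset.range A, (A : ℝ) * (‖p.coeff (a + 1)‖ * ρ ^ (a + 1)) := by
    refine Finset.sum_le_sum fun a ha => ?_
    rw [coeff_derivative, norm_mul]
    have : ‖((a : ℂ) + 1)‖ ≤ A := by
      have : ‖(((a + 1 : ℕ)) : ℂ)‖ = ((a + 1 : ℕ) : ℝ) := Complex.norm_natCast _
      push_cast at this
      rw [this]; exact_mod_cast Finset.mem_range.1 ha
    have h2 : ρ ^ a ≤ ρ ^ (a + 1) := pow_le_pow_right₀ hρ (by omega)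
    calc ‖p.coeff (a + 1)‖ * ‖((a : ℂ) + 1)‖ * ρ ^ a ≤ ‖p.coeff (a + 1)‖ * A * ρ ^ (a + 1) := by
          gcongr
      _ = _ := by ring
  refine h1.trans ?_
  rw [← Finset.mul_sum]
  gcongr
  have h3 := Finset.sum_range_succ (fun a => ‖p.coeff a‖ * ρ ^ a) A
  have h4 := Finset.sum_range_succ' (fun a => ‖p.coeff a‖ * ρ ^ a) A
  rw [h4] at h3
  simp only [hA, norm_zero, zero_mul, add_zero] at h3
  unfold wn
  rw [← h3]
  simp

lemma deg_derivative (A : ℕ) (p : ℂ[X]) (hp : p ∈ degreeLT ℂ A) : derivative p ∈ degreeLT ℂ A := by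
  rw [mem_degreeLT] at *
  exact (degree_derivative_le).trans_lt hp

lemma wn_act_list (A : ℕ) {ρ M : ℝ} (hρ : 1 ≤ ρ) (hM : 0 ≤ M) (l : List ℂ[X]) (p : ℂ[X])
    (hp : p ∈ degreeLT ℂ A)
    (hl : ∀ θ ∈ l, ∃ c e : ℂ, θ = C c * X + C e ∧ ‖c‖ * A + ‖e‖ ≤ M) :
    act l.prod p ∈ degreeLT ℂ A ∧ wn A ρ (act l.prod p) ≤ M ^ l.length * wn A ρ p := by
  induction l with
  | nil => simpa [act_one] using hp
  | cons θ l ih =>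
    obtain ⟨h1, h2⟩ := ih (fun θ hθ => hl θ (by simp [hθ]))
    obtain ⟨c, e, rfl, hce⟩ := hl θ (by simp)
    have h0 : 0 ≤ ρ := by linarith
    rw [List.prod_cons, act_mul, act_add_left, act_mul, act_C, act_C, act_X]
    set r := act l.prod p
    constructor
    · apply Submodule.add_mem
      · rw [← smul_eq_C_mul]; exact Submodule.smul_mem _ _ (deg_derivative _ _ h1)
      · rw [← smul_eq_C_mul]; exact Submodule.smul_mem _ _ h1
    · calc _ ≤ _ := wn_add A h0 _ _
        _ = ‖c‖ * wn A ρ (derivative r) + ‖e‖ * wn A ρ r := by rw [wn_C_mul, wn_C_mul]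
        _ ≤ ‖c‖ * (A * wn A ρ r) + ‖e‖ * wn A ρ r := by
            gcongr; exact wn_derivative A hρ r h1
        _ = (‖c‖ * A + ‖e‖) * wn A ρ r := by ring
        _ ≤ M * (M ^ l.length * wn A ρ p) := by
            have := wn_nonneg A h0 r
            gcongr
        _ = _ := by rw [List.length_cons, pow_succ]; ring
end PartA

section PartB
open Polynomial

lemma act_eq_zero_of_X_pow_dvd {p θ : ℂ[X]} {A : ℕ} (hp : p.natDegree < A) (h : X ^ A ∣ θ) :
    act θ p = 0 := by
  obtain ⟨φ, rfl⟩ := h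
  rw [mul_comm, act_mul]
  have : act (X ^ A) p = derivative^[A] p := by
    simp [act, Module.End.pow_apply]
  rw [this, iterate_derivative_eq_zero hp, act_zero]

lemma exp_poly_indep {Δ : Type*} [Fintype Δ] [DecidableEq Δ] (d : Δ → ℂ) (hd : Function.Injective d)
    (P : Δ → ℂ[X])
    (h : ∀ j : ℕ, ∑ δ, (act ((X + C (d δ)) ^ j) (P δ)).eval 0 = 0) : P = 0 := by
  have h' : ∀ f : ℂ[X], ∑ δ, (act (f.comp (X + C (d δ))) (P δ)).eval 0 = 0 := by
    intro f
    induction f using Polynomial.induction_on' with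
    | add p q hp hq =>
      simp only [add_comp, act_add_left, eval_add, Finset.sum_add_distrib, hp, hq, add_zero]
    | monomial n a =>
      simp only [monomial_comp, act_mul, act_C, eval_mul, eval_C, ← Finset.mul_sum, h, mul_zero]
  by_contra hP
  obtain ⟨δ₀, hδ₀⟩ := Function.ne_iff.1 hP
  obtain ⟨A, hA⟩ : ∃ A, ∀ δ, (P δ).natDegree < A :=
    ⟨(Finset.univ.sup fun δ => (P δ).natDegree) + 1, fun δ =>
      Nat.lt_succ_of_le (Finset.le_sup (f := fun δ => (P δ).natDegree) (Finset.mem_univ δ))⟩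
  set i := (P δ₀).natDegree
  have h1 := h' ((∏ δ ∈ Finset.univ.erase δ₀, (X - C (d δ)) ^ A) * (X - C (d δ₀)) ^ i)
  rw [Finset.sum_eq_single δ₀] at h1
  · rw [mul_comp, act_mul, prod_comp] at h1
    have h2 : act (((X - C (d δ₀)) ^ i).comp (X + C (d δ₀))) (P δ₀) =
        C ((i.factorial : ℂ) * (P δ₀).leadingCoeff) := by
      have : ((X - C (d δ₀)) ^ i).comp (X + C (d δ₀)) = X ^ i := by simp
      rw [this]
      have : act (X ^ i) (P δ₀) = derivative^[i] (P δ₀) := by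
        simp [act, Module.End.pow_apply]
      rw [this]
      have hdeg : (derivative^[i] (P δ₀)).natDegree ≤ 0 := by
        have := natDegree_iterate_derivative (P δ₀) i
        simpa [i] using this
      rw [eq_C_of_natDegree_le_zero hdeg, coeff_iterate_derivative]
      simp [i, Nat.descFactorial_self]
    rw [h2] at h1
    have h3 : ∀ (θ : ℂ[X]) (c : ℂ), act θ (C c) = C (θ.eval 0 * c) := by
      intro θ c
      induction θ using Polynomial.induction_on' with
      | add p q hp hq => rw [act_add_left, hp, hq, eval_add, add_mul, C_add]
      | monomial n a =>
        rw [← C_mul_X_pow_eq_monomial, act_mul]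
        rcases n with _ | n
        · simp [act_one, act_C]
        · rw [act_eq_zero_of_X_pow_dvd (A := n + 1) (by simp) (dvd_refl _), act_zero]; simp
    rw [h3, eval_C] at h1
    have hl : (P δ₀).leadingCoeff ≠ 0 := leadingCoeff_ne_zero.2 hδ₀
    have hf : (i.factorial : ℂ) ≠ 0 := by exact_mod_cast i.factorial_ne_zero
    refine (mul_ne_zero ?_ (mul_ne_zero hf hl)) h1
    rw [eval_prod, Finset.prod_ne_zero_iff]
    intro δ hδ
    have : d δ₀ ≠ d δ := fun h => (Finset.ne_of_mem_erase hδ) (hd h).symm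
    simp [sub_eq_zero, this]
  · intro δ _ hδ
    rw [act_eq_zero_of_X_pow_dvd (hA δ), eval_zero]
    rw [mul_comp, prod_comp]
    apply Dvd.dvd.mul_right
    have : X ^ A = ((X - C (d δ)) ^ A).comp (X + C (d δ)) := by simp
    rw [this]
    exact Finset.dvd_prod_of_mem (fun δ' => ((X - C (d δ')) ^ A).comp (X + C (d δ)))
      (Finset.mem_erase.2 ⟨hδ, Finset.mem_univ _⟩)
  · simp
end PartB

section PartC
open Polynomial NumberField

section ev
variable {Δ : Type*} [Fintype Δ]

/-- evaluation functional -/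
noncomputable def evf (P : Δ → ℂ[X]) (w : ℂ) (E : Δ → ℂ) : (Δ → ℂ[X]) →ₗ[ℂ] ℂ where
  toFun Q := ∑ δ, (act (Q δ) (P δ)).eval w * Complex.exp (E δ)
  map_add' Q Q' := by
    simp only [Pi.add_apply, act_add_left, eval_add, add_mul, Finset.sum_add_distrib]
  map_smul' c Q := by
    simp only [Pi.smul_apply, act_smul_left, eval_mul, eval_C, mul_assoc, Finset.mul_sum,
      smul_eq_mul, RingHom.id_apply]

lemma evf_apply (P : Δ → ℂ[X]) (w : ℂ) (E : Δ → ℂ) (Q) :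
    evf P w E Q = ∑ δ, (act (Q δ) (P δ)).eval w * Complex.exp (E δ) := rfl

lemma evf_hasDerivAt (P : Δ → ℂ[X]) (w₀ w₁ : ℂ) (E₀ E₁ : Δ → ℂ) (Q : Δ → ℂ[X]) (ζ : ℂ) :
    HasDerivAt (fun ζ => evf P (w₀ + ζ * w₁) (fun δ => E₀ δ + ζ * E₁ δ) Q)
      (evf P (w₀ + ζ * w₁) (fun δ => E₀ δ + ζ * E₁ δ)
        ((fun δ => C w₁ * X + C (E₁ δ)) * Q)) ζ := by
  simp only [evf_apply]
  apply HasDerivAt.fun_sum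
  intro δ _
  simp only [Pi.mul_apply, act_mul, act_add_left, act_C, act_X, eval_add, eval_mul, eval_C]
  have hw : HasDerivAt (fun ζ : ℂ => w₀ + ζ * w₁) w₁ ζ := by
    simpa using ((hasDerivAt_id ζ).mul_const w₁).const_add w₀
  have hE : HasDerivAt (fun ζ : ℂ => E₀ δ + ζ * E₁ δ) (E₁ δ) ζ := by
    simpa using ((hasDerivAt_id ζ).mul_const (E₁ δ)).const_add (E₀ δ)
  have h1 := ((act (Q δ) (P δ)).hasDerivAt (w₀ + ζ * w₁)).comp ζ hw
  have h2 := h1.mul hE.cexp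
  refine h2.congr_deriv ?_
  simp only [Function.comp]
  ring

lemma evf_iteratedDeriv (P : Δ → ℂ[X]) (w₀ w₁ : ℂ) (E₀ E₁ : Δ → ℂ) (i : ℕ) : ∀ (Q : Δ → ℂ[X]),
    iteratedDeriv i (fun ζ => evf P (w₀ + ζ * w₁) (fun δ => E₀ δ + ζ * E₁ δ) Q) =
      fun ζ => evf P (w₀ + ζ * w₁) (fun δ => E₀ δ + ζ * E₁ δ)
        ((fun δ => C w₁ * X + C (E₁ δ)) ^ i * Q) := by
  induction i with
  | zero => intro Q; simp
  | succ i ih =>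
    intro Q
    rw [iteratedDeriv_succ']
    have : deriv (fun ζ => evf P (w₀ + ζ * w₁) (fun δ => E₀ δ + ζ * E₁ δ) Q) =
      fun ζ => evf P (w₀ + ζ * w₁) (fun δ => E₀ δ + ζ * E₁ δ)
        ((fun δ => C w₁ * X + C (E₁ δ)) * Q) := by
      funext ζ; exact (evf_hasDerivAt P w₀ w₁ E₀ E₁ Q ζ).deriv
    rw [this, ih]
    simp only [pow_succ, mul_assoc]

lemma line_estimate (P : Δ → ℂ[X]) (w₀ w₁ : ℂ) (E₀ E₁ : Δ → ℂ) (Q : Δ → ℂ[X])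
    (S e : ℕ) (R M : ℝ) (hS : 1 ≤ S) (hR : 4 * (S : ℝ) ≤ R)
    (hM : ∀ ζ : ℂ, ‖ζ‖ ≤ R → ‖evf P (w₀ + ζ * w₁) (fun δ => E₀ δ + ζ * E₁ δ) Q‖ ≤ M)
    (hv : ∀ s < S, ∀ i < e, evf P (w₀ + (s : ℂ) * w₁) (fun δ => E₀ δ + (s : ℂ) * E₁ δ)
        ((fun δ => C w₁ * X + C (E₁ δ)) ^ i * Q) = 0) (s : ℕ) (hs : s < S) :
    ‖evf P (w₀ + (s : ℂ) * w₁) (fun δ => E₀ δ + (s : ℂ) * E₁ δ)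
        ((fun δ => C w₁ * X + C (E₁ δ)) ^ e * Q)‖ ≤
      e.factorial * (M * (4 * S / R) ^ (S * e)) := by
  have := zero_estimate (fun ζ => evf P (w₀ + ζ * w₁) (fun δ => E₀ δ + ζ * E₁ δ) Q)
    (fun ζ => (evf_hasDerivAt P w₀ w₁ E₀ E₁ Q ζ).differentiableAt) S e R M hS hR
    (fun s hs i hi => by rw [evf_iteratedDeriv]; exact hv s hs i hi) hM s hs
  rwa [evf_iteratedDeriv] at this

lemma evf_bound (P : Δ → ℂ[X]) (A : ℕ) (hP : ∀ δ, P δ ∈ degreeLT ℂ A) (w : ℂ) (E : Δ → ℂ)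
    (ρ M W Eb : ℝ) (hρ : 1 ≤ ρ) (hM : 0 ≤ M) (hw : ‖w‖ ≤ ρ) (hE : ∀ δ, ‖E δ‖ ≤ Eb)
    (hW : ∀ δ, wn A ρ (P δ) ≤ W)
    (l : List (Δ → ℂ[X]))
    (hl : ∀ θ ∈ l, ∀ δ, ∃ c e : ℂ, θ δ = C c * X + C e ∧ ‖c‖ * A + ‖e‖ ≤ M) :
    ‖evf P w E l.prod‖ ≤ Fintype.card Δ * (M ^ l.length * W * Real.exp Eb) := by
  rw [evf_apply]
  refine (norm_sum_le _ _).trans ?_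
  have : ∀ δ ∈ Finset.univ, ‖(act (l.prod δ) (P δ)).eval w * Complex.exp (E δ)‖ ≤
      M ^ l.length * W * Real.exp Eb := by
    intro δ _
    have hlp : l.prod δ = (l.map (fun θ => θ δ)).prod := by
      have := map_list_prod (Pi.evalRingHom (fun _ : Δ => ℂ[X]) δ) l
      exact this
    obtain ⟨h1, h2⟩ := wn_act_list A hρ hM (l.map (fun θ => θ δ)) (P δ) (hP δ) (by
      intro θ hθ
      obtain ⟨θ', h, rfl⟩ := List.mem_map.1 hθ
      exact hl θ' h δ)
    rw [← hlp, List.length_map] at h2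
    rw [← hlp] at h1
    rw [norm_mul, Complex.norm_exp]
    have h3 := eval_le_wn A _ h1 w hw
    have h4 : Real.exp (E δ).re ≤ Real.exp Eb :=
      Real.exp_le_exp.2 ((Complex.re_le_norm _).trans (hE δ))
    have h5 : M ^ l.length * wn A ρ (P δ) ≤ M ^ l.length * W := by gcongr; exact hW δ
    have h6 : 0 ≤ wn A ρ (P δ) := wn_nonneg A (by linarith) _
    have h7 : 0 ≤ M ^ l.length * W := (by positivity : 0 ≤ M ^ l.length * wn A ρ (P δ)).trans h5
    exact mul_le_mul (h3.trans (h2.trans h5)) h4 (Real.exp_pos _).le h7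
  refine (Finset.sum_le_sum this).trans ?_
  simp
end ev

lemma siegel_K (K : Type) [Field K] [NumberField K] : ∃ c : ℝ, 1 ≤ c ∧
    ∀ (α β : Type) [Fintype α] [Fintype β] [DecidableEq α] [DecidableEq β]
      (a : Matrix α β (𝓞 K)) (H : ℝ), 1 ≤ H →
      (∀ k l, house (a k l : K) ≤ H) → 0 < Fintype.card α → 2 * Fintype.card α ≤ Fintype.card β →
      ∃ ξ : β → 𝓞 K, ξ ≠ 0 ∧ a.mulVec ξ = 0 ∧ ∀ l, house (ξ l : K) ≤ c * Fintype.card β * H := by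
  obtain ⟨c₁, hc₁⟩ : ∃ c₁ : ℝ, ∀ (α β : Type) [Fintype α] [Fintype β] [DecidableEq α] [DecidableEq β]
      (a : Matrix α β (𝓞 K)) (H : ℝ), a ≠ 0 →
      (∀ k l, house (a k l : K) ≤ H) → 0 < Fintype.card α → Fintype.card α < Fintype.card β →
      ∃ ξ : β → 𝓞 K, ξ ≠ 0 ∧ a.mulVec ξ = 0 ∧ ∀ l, house (ξ l : K) ≤
        c₁ * ((c₁ * Fintype.card β * H) ^ ((Fintype.card α : ℝ) / (Fintype.card β - Fintype.card α))) := by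
    classical
    apply Exists.intro
    intro α β _ _ _ _ a H ha hH h1 h2
    exact NumberField.house.exists_ne_zero_int_vec_house_le K a ha h1 h2 rfl hH rfl
  set c := max 1 |c₁| with hc
  have hc1 : 1 ≤ c := le_max_left _ _
  have hcc : |c₁| ≤ c := le_max_right _ _
  refine ⟨c * c, by nlinarith, ?_⟩
  intro α β _ _ _ _ a H hH hb h1 h2
  have hβ : (1 : ℝ) ≤ Fintype.card β := by exact_mod_cast (by omega : 1 ≤ Fintype.card β)
  have hα : (0 : ℝ) < Fintype.card α := by exact_mod_cast h1
  have h2' : 2 * (Fintype.card α : ℝ) ≤ Fintype.card β := by exact_mod_cast h2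
  by_cases ha : a = 0
  · refine ⟨fun _ => 1, ?_, by simp [ha], fun l => ?_⟩
    · have : Nonempty β := Fintype.card_pos_iff.1 (by omega)
      exact fun h => one_ne_zero (congrFun h this.some)
    · have : house ((1 : 𝓞 K) : K) = 1 := by simpa using house_intCast (K := K) 1
      rw [this]
      have : 1 ≤ c * c := by nlinarith
      have : 1 ≤ c * c * Fintype.card β := by nlinarith
      nlinarith
  · obtain ⟨ξ, hξ, h3, h4⟩ := hc₁ α β a H ha hb h1 (by omega)
    refine ⟨ξ, hξ, h3, fun l => (h4 l).trans ?_⟩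
    set y : ℝ := (Fintype.card α : ℝ) / (Fintype.card β - Fintype.card α) with hy
    have hy0 : 0 ≤ y := div_nonneg hα.le (by linarith)
    have hy1 : y ≤ 1 := by rw [hy, div_le_one (by linarith)]; linarith
    have hx1 : 1 ≤ c * Fintype.card β * H := by
      have : 1 ≤ c * Fintype.card β := by nlinarith
      nlinarith
    calc _ ≤ |c₁ * (c₁ * Fintype.card β * H) ^ y| := le_abs_self _
      _ ≤ |c₁| * |c₁ * Fintype.card β * H| ^ y := by
          rw [abs_mul]; gcongr; exact Real.abs_rpow_le_abs_rpow _ _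
      _ ≤ c * (c * Fintype.card β * H) ^ y := by
          have : |c₁ * Fintype.card β * H| ≤ c * Fintype.card β * H := by
            rw [abs_mul, abs_mul, abs_of_pos (by linarith : 0 < H),
              abs_of_pos (by linarith : (0:ℝ) < Fintype.card β)]
            gcongr
          gcongr
      _ ≤ c * (c * Fintype.card β * H) ^ (1 : ℝ) := by
          gcongr
      _ = _ := by rw [Real.rpow_one]; ring

open Classical in
/-- dual basis -/
lemma dual_matrix (K : Type) [Field K] [NumberField K] [IsGalois ℚ K] (ι : K →+* ℂ)
    {J : Type} [Fintype J] [DecidableEq J] (b : Module.Basis J ℚ K) :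
    ∃ c : Gal(K/ℚ) → J → ℂ, ∀ σ τ : Gal(K/ℚ), ∑ k, c σ k * ι (τ (b k)) = if σ = τ then 1 else 0 := by
  let b' := (Algebra.traceForm ℚ K).dualBasis (traceForm_nondegenerate ℚ K) b
  let M : Matrix Gal(K/ℚ) J ℂ := Matrix.of fun σ k => ι (σ (b k))
  let M' : Matrix Gal(K/ℚ) J ℂ := Matrix.of fun σ k => ι (σ (b' k))
  have h1 : M.transpose * M' = 1 := by
    ext k l
    simp only [Matrix.mul_apply, Matrix.transpose_apply, M, M', Matrix.of_apply, ← map_mul, ← map_sum]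
    have := trace_eq_sum_automorphisms (K := ℚ) (L := K) (b k * b' l)
    rw [← this]
    have h2 : Algebra.trace ℚ K (b k * b' l) = if k = l then 1 else 0 := by
      have := LinearMap.BilinForm.apply_dualBasis_right (B := Algebra.traceForm ℚ K)
        (hB := traceForm_nondegenerate ℚ K) (sym := Algebra.traceForm_isSymm ℚ) (b := b) k l
      simpa [Algebra.traceForm_apply] using this
    rw [h2, Matrix.one_apply]
    split_ifs <;> simp
  have hcard : Fintype.card J = Fintype.card Gal(K/ℚ) := by
    rw [← Module.finrank_eq_card_basis b, ← Nat.card_eq_fintype_card, IsGalois.card_aut_eq_finrank]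
  have h2 : M' * M.transpose = 1 := (Matrix.mul_eq_one_comm_of_card_eq _ _ _ hcard).1 h1
  refine ⟨M', fun σ τ => ?_⟩
  have := congrFun (congrFun h2 σ) τ
  simpa [Matrix.mul_apply, Matrix.one_apply, M] using this
end PartC

section PartD
open Polynomial NumberField

lemma list_count_sum {J : Type*} [Fintype J] [DecidableEq J] (l : List J) :
    ∑ k, l.count k = l.length := by
  induction l with
  | nil => simp
  | cons a l ih => simp [List.count_cons, Finset.sum_add_distrib, ih]

lemma list_pigeon {J : Type*} [Fintype J] [DecidableEq J] [Nonempty J] (l : List J) :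
    ∃ k, l.length ≤ Fintype.card J * l.count k := by
  by_contra! h
  have h1 : ∑ k : J, Fintype.card J * l.count k < ∑ k : J, l.length :=
    Finset.sum_lt_sum_of_nonempty Finset.univ_nonempty (fun k _ => h k)
  rw [← Finset.mul_sum, list_count_sum] at h1
  simp at h1

lemma list_split {J A : Type*} [DecidableEq J] [CommMonoid A] (l : List J) (k : J) (Y : J → A) :
    (l.map Y).prod = Y k ^ (l.count k) * ((l.filter (· ≠ k)).map Y).prod ∧
      l.count k + (l.filter (· ≠ k)).length = l.length := by
  induction l with
  | nil => simp
  | cons a l ih =>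
    obtain ⟨h1, h2⟩ := ih
    by_cases h : a = k
    · subst h
      simp only [List.map_cons, List.prod_cons, h1, List.count_cons_self, ne_eq, not_true_eq_false,
        decide_false, Bool.false_eq_true, not_false_eq_true, List.filter_cons_of_neg, pow_succ,
        List.length_cons]
      refine ⟨by rw [mul_comm _ (Y a), mul_assoc], ?_⟩
      simp only [ne_eq] at h2
      omega
    · have h' : (k == a) = false := by simpa using fun hh => h hh.symm
      simp only [List.map_cons, List.prod_cons, h1, ne_eq, h, not_false_eq_true, decide_true,
        List.filter_cons_of_pos, List.length_cons, List.count_cons_of_ne h]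
      refine ⟨by rw [← mul_assoc, ← mul_assoc, mul_comm (Y a)], ?_⟩
      simp only [ne_eq] at h2
      omega

lemma norm_comb_le {J : Type*} [Fintype J] (s : J → ℕ) (S : ℕ) (hs : ∀ k, s k ≤ S) (f : J → ℂ)
    (b : ℝ) (hf : ∀ k, ‖f k‖ ≤ b) (hb : 0 ≤ b) :
    ‖∑ k, (s k : ℂ) * f k‖ ≤ Fintype.card J * S * b := by
  refine (norm_sum_le _ _).trans ?_
  have : ∀ k ∈ Finset.univ, ‖(s k : ℂ) * f k‖ ≤ S * b := by
    intro k _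
    rw [norm_mul, Complex.norm_natCast]
    have : (s k : ℝ) ≤ S := by exact_mod_cast hs k
    have := hf k
    gcongr
  refine (Finset.sum_le_sum this).trans ?_
  simp [mul_assoc]

lemma upper_bound {Δ I J : Type*} [Fintype Δ] [Fintype I] [Fintype J] [DecidableEq J] [Nonempty J]
    (P : Δ → ℂ[X]) (A : ℕ) (hP : ∀ δ, P δ ∈ degreeLT ℂ A)
    (w₁ : J → ℂ) (E₁ : J → Δ → ℂ) (Xop : I → Δ → ℂ[X])
    (Yop : J → Δ → ℂ[X]) (hYop : ∀ k, Yop k = fun δ => C (w₁ k) * X + C (E₁ k δ))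
    (c : I → J → ℂ) (hX : ∀ i, Xop i = ∑ k, c i k • Yop k)
    (c' : J → I → ℂ) (hY : ∀ k, Yop k = ∑ i, c' k i • Xop i)
    (S : ℕ) (hS : 1 ≤ S) (m : ℕ)
    (hvan : ∀ s : J → ℕ, (∀ k, s k < S) → ∀ l : List I, l.length < m →
      evf P (∑ k, (s k : ℂ) * w₁ k) (fun δ => ∑ k, (s k : ℂ) * E₁ k δ) (l.map Xop).prod = 0)
    (Cc M₁ R ρ W w e₀ D : ℝ) (hCc : ∀ i, ∑ k, ‖c i k‖ ≤ Cc) (hCc0 : 0 ≤ Cc)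
    (hM₁ : ∀ k δ, ‖w₁ k‖ * A + ‖E₁ k δ‖ ≤ M₁) (hM₁0 : 0 ≤ M₁)
    (hw : ∀ k, ‖w₁ k‖ ≤ w) (hw0 : 0 ≤ w) (he : ∀ k δ, ‖E₁ k δ‖ ≤ e₀) (he0 : 0 ≤ e₀)
    (hR : 4 * (S : ℝ) ≤ R) (hρ : 1 ≤ ρ) (hρ' : (Fintype.card J + 1) * R * w ≤ ρ)
    (hW : ∀ δ, wn A ρ (P δ) ≤ W)
    (hD : ∀ e ≤ m, m ≤ Fintype.card J * e →
      e.factorial * (Fintype.card Δ * (M₁ ^ (m - e) * W *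
        Real.exp ((Fintype.card J + 1) * R * e₀)) * (4 * S / R) ^ (S * e)) ≤ D) (hD0 : 0 ≤ D)
    (s : J → ℕ) (hs : ∀ k, s k < S) (l : List I) (hl : l.length = m) :
    ‖evf P (∑ k, (s k : ℂ) * w₁ k) (fun δ => ∑ k, (s k : ℂ) * E₁ k δ) (l.map Xop).prod‖
      ≤ Cc ^ m * D := by
  have hS' : (1 : ℝ) ≤ S := by exact_mod_cast hS
  have hR0 : 0 ≤ R := by linarith
  have hvanY : ∀ s : J → ℕ, (∀ k, s k < S) → ∀ l : List J, l.length < m →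
      evf P (∑ k, (s k : ℂ) * w₁ k) (fun δ => ∑ k, (s k : ℂ) * E₁ k δ) (l.map Yop).prod = 0 := by
    intro s hs l hl
    obtain ⟨C2, hC2⟩ : ∃ C2 : ℝ, ∀ k, ∑ i, ‖c' k i‖ ≤ C2 :=
      ⟨∑ k, ∑ i, ‖c' k i‖, fun k => Finset.single_le_sum (f := fun k => ∑ i, ‖c' k i‖)
        (fun _ _ => by positivity) (Finset.mem_univ k)⟩
    have h0 : 0 ≤ C2 := le_trans (by positivity) (hC2 (Classical.arbitrary J))
    have := expand_bound (evf P (∑ k, (s k : ℂ) * w₁ k) (fun δ => ∑ k, (s k : ℂ) * E₁ k δ))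
      Yop Xop c' hY C2 0 hC2 l.length h0 le_rfl
      (fun l' hl' => by rw [hvan s hs l' (by omega), norm_zero]) l rfl
    simpa using this
  refine expand_bound _ Xop Yop c hX Cc D hCc m hCc0 hD0 ?_ l hl
  intro q hq
  obtain ⟨k, hk⟩ := list_pigeon q
  obtain ⟨hq1, hq2⟩ := list_split q k Yop
  set e := q.count k with he_def
  set r := q.filter (· ≠ k) with hr
  have hline : ∀ (t : ℕ) (f : J → ℂ), ∑ j, ((Function.update s k t j : ℕ) : ℂ) * f j =
      ∑ j, ((Function.update s k 0 j : ℕ) : ℂ) * f j + (t : ℂ) * f k := by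
    intro t f
    rw [← Finset.add_sum_erase _ _ (Finset.mem_univ k),
      ← Finset.add_sum_erase _ (fun j => ((Function.update s k 0 j : ℕ) : ℂ) * f j)
        (Finset.mem_univ k)]
    simp only [Function.update_self, Nat.cast_zero, zero_mul, zero_add]
    rw [add_comm]
    congr 1
    refine Finset.sum_congr rfl fun j hj => ?_
    have := Finset.ne_of_mem_erase hj
    simp [Function.update_of_ne this]
  have hupd : ∀ t < S, ∀ j, Function.update s k t j < S := by
    intro t ht j
    by_cases h : j = k
    · subst h; simpa using ht
    · simpa [Function.update_of_ne h] using hs j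
  have main := line_estimate P (∑ j, ((Function.update s k 0 j : ℕ) : ℂ) * w₁ j) (w₁ k)
    (fun δ => ∑ j, ((Function.update s k 0 j : ℕ) : ℂ) * E₁ j δ) (E₁ k) (r.map Yop).prod S e R
    (Fintype.card Δ * (M₁ ^ (m - e) * W * Real.exp ((Fintype.card J + 1) * R * e₀))) hS hR ?_ ?_
    (s k) (hs k)
  · rw [← hYop k, ← hq1, ← hline (s k) w₁, Function.update_eq_self] at main
    simp only [← hline (s k), Function.update_eq_self] at main
    exact main.trans (hD e (by omega) (by omega))
  · intro ζ hζ
    have hlen : (r.map Yop).length = m - e := by rw [List.length_map]; omega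
    rw [← hlen]
    have hb : ∀ (f : J → ℂ) (b : ℝ), (∀ j, ‖f j‖ ≤ b) → 0 ≤ b →
        ‖∑ j, ((Function.update s k 0 j : ℕ) : ℂ) * f j + ζ * f k‖ ≤ (Fintype.card J + 1) * R * b := by
      intro f b hf hb
      have h1 := norm_comb_le (Function.update s k 0) S (fun j => (hupd 0 (by omega) j).le) f b hf hb
      calc _ ≤ _ := norm_add_le _ _
        _ ≤ Fintype.card J * S * b + R * b := by
            rw [norm_mul]; have := hf k; gcongr
        _ ≤ Fintype.card J * R * b + R * b := by gcongr; linarith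
        _ = _ := by ring
    apply evf_bound P A hP _ _ ρ M₁ W _ hρ hM₁0 ((hb w₁ w hw hw0).trans hρ')
      (fun δ => hb (fun j => E₁ j δ) e₀ (fun j => he j δ) he0) hW
    intro θ hθ δ
    obtain ⟨j, _, rfl⟩ := List.mem_map.1 hθ
    exact ⟨w₁ j, E₁ j δ, by rw [hYop j], hM₁ j δ⟩
  · intro t ht i hi
    rw [← hYop k, ← hline t w₁]
    simp only [← hline t]
    have : Yop k ^ i * (r.map Yop).prod = ((List.replicate i k ++ r).map Yop).prod := by simp
    rw [this]
    exact hvanY _ (hupd t ht) _ (by simp; omega)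
end PartD

section PartE
open Polynomial NumberField

lemma house_le_of (K : Type) [Field K] [NumberField K] (x : K) (b : ℝ)
    (h : ∀ τ : K →+* ℂ, ‖τ x‖ ≤ b) : house x ≤ b := by
  rw [house_eq_sup']
  obtain ⟨τ, -, hτ⟩ := Finset.exists_mem_eq_sup' (s := (Finset.univ : Finset (K →+* ℂ)))
    Finset.univ_nonempty (fun φ : K →+* ℂ ↦ ‖φ x‖₊)
  rw [hτ]; exact h τ

lemma integer_lower (K : Type) [Field K] [NumberField K] (x : 𝓞 K) (hx : x ≠ 0) (ι : K →+* ℂ) :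
    1 ≤ ‖ι x‖ * house (x : K) ^ (Module.finrank ℚ K - 1) := by
  refine le_trans ?_ (norm_norm_le_norm_mul_house_pow (x : K) ι)
  rw [← Algebra.coe_norm_int]
  have h : Algebra.norm ℤ x ≠ 0 := Algebra.norm_ne_zero_iff.2 hx
  have h2 := Int.one_le_abs h
  have h3 : ‖((Algebra.norm ℤ x : ℤ) : ℚ)‖ = |((Algebra.norm ℤ x : ℤ) : ℝ)| := by
    rw [Int.norm_cast_rat, Int.norm_eq_abs]
  rw [h3]; exact_mod_cast h2

lemma oi_sum {K : Type} [Field K] {α : Type*} (s : Finset α) (f : α → 𝓞 K) :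
    ((∑ i ∈ s, f i : 𝓞 K) : K) = ∑ i ∈ s, (f i : K) := map_sum (algebraMap (𝓞 K) K) f s
lemma oi_mul {K : Type} [Field K] (x y : 𝓞 K) :
    ((x * y : 𝓞 K) : K) = (x : K) * (y : K) := rfl
lemma oi_zero {K : Type} [Field K] : ((0 : 𝓞 K) : K) = 0 := rfl

/-- matrix entries -/
noncomputable def entry {R I : Type*} [CommRing R] (th : I → R[X]) (g V : R) (l : List I) (a : ℕ) : R :=
  (act (l.map th).prod (X ^ a)).eval g * V

lemma entry_map {R R' I : Type*} [CommRing R] [CommRing R'] (f : R →+* R') (th : I → R[X]) (g V : R)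
    (l : List I) (a : ℕ) :
    f (entry th g V l a) = entry (fun i => (th i).map f) (f g) (f V) l a := by
  unfold entry
  rw [map_mul, ← Polynomial.eval_map_apply, act_map, Polynomial.map_pow, Polynomial.map_X, Polynomial.map_list_prod,
    List.map_map]
  rfl

lemma entry_bound {I : Type*} (c e : I → ℂ) (g V : ℂ) (l : List I) (A a : ℕ) (ha : a < A) (M ρ v : ℝ)
    (hM : 0 ≤ M) (hρ : 1 ≤ ρ) (hce : ∀ i, ‖c i‖ * A + ‖e i‖ ≤ M) (hg : ‖g‖ ≤ ρ) (hV : ‖V‖ ≤ v) :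
    ‖entry (fun i => C (c i) * X + C (e i)) g V l a‖ ≤ M ^ l.length * ρ ^ A * v := by
  unfold entry
  have hXa : (X ^ a : ℂ[X]) ∈ degreeLT ℂ A := by
    rw [mem_degreeLT, degree_X_pow]; exact_mod_cast ha
  obtain ⟨h1, h2⟩ := wn_act_list A hρ hM (l.map (fun i => C (c i) * X + C (e i))) (X ^ a) hXa (by
    intro θ hθ
    obtain ⟨i, _, rfl⟩ := List.mem_map.1 hθ
    exact ⟨c i, e i, rfl, hce i⟩)
  have h3 := eval_le_wn A _ h1 g hg
  have h4 : wn A ρ (X ^ a) = ρ ^ a := by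
    unfold wn
    rw [Finset.sum_eq_single a]
    · simp
    · intro b _ hb; simp [coeff_X_pow, hb]
    · simp; omega
  rw [norm_mul]
  rw [h4, List.length_map] at h2
  have h5 : ρ ^ a ≤ ρ ^ A := pow_le_pow_right₀ hρ ha.le
  gcongr
  exact (h3.trans h2).trans (by gcongr)

lemma evf_entry {Δ I : Type*} [Fintype Δ] (A : ℕ) (x : Fin A × Δ → ℂ) (th : I → Δ → ℂ[X]) (g q : ℂ)
    (V E : Δ → ℂ) (hV : ∀ δ, V δ = q * Complex.exp (E δ)) (l : List I) :
    ∑ p : Fin A × Δ, entry (fun i => th i p.2) g (V p.2) l p.1 * x p =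
      q * evf (fun δ => ∑ a : Fin A, C (x (a, δ)) * X ^ (a : ℕ)) g E (l.map th).prod := by
  rw [evf_apply, Fintype.sum_prod_type_right, Finset.mul_sum]
  refine Finset.sum_congr rfl fun δ _ => ?_
  have hlp : (l.map th).prod δ = (l.map (fun i => th i δ)).prod := by
    have := map_list_prod (Pi.evalRingHom (fun _ : Δ => ℂ[X]) δ) (l.map th)
    rw [List.map_map] at this
    exact this
  rw [hlp, act_sum, eval_finset_sum, Finset.sum_mul, Finset.mul_sum]
  refine Finset.sum_congr rfl fun a _ => ?_
  simp only [entry, act_C_mul, eval_mul, eval_C, hV]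
  ring

lemma prod_eq_count {I A : Type*} [Fintype I] [DecidableEq I] [CommMonoid A] (f : I → A) (l : List I) :
    (l.map f).prod = ∏ i, f i ^ l.count i := by
  induction l with
  | nil => simp
  | cons a l ih =>
    rw [List.map_cons, List.prod_cons, ih]
    simp only [List.count_cons, pow_add, Finset.prod_mul_distrib]
    rw [mul_comm]
    congr 1
    rw [Finset.prod_eq_single a]
    · simp
    · intro b _ hb; simp [Ne.symm hb]
    · simp

lemma exists_list_count {I : Type*} [Fintype I] [DecidableEq I] (f : I → ℕ) :
    ∃ l : List I, (∀ i, l.count i = f i) ∧ l.length = ∑ i, f i := by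
  let m : Multiset I := ∑ i, f i • {i}
  have hc : ∀ i, m.count i = f i := by
    intro i
    simp [m, Multiset.count_sum', Multiset.count_singleton]
  refine ⟨m.toList, fun i => ?_, ?_⟩
  · rw [← hc i, ← Multiset.coe_count, Multiset.coe_toList]
  · simp [m]

lemma wn_sum_le (A : ℕ) (x : Fin A → ℂ) (h : ℝ) (hx : ∀ a, ‖x a‖ ≤ h) (hh : 0 ≤ h) (r : ℝ) (hr : 1 ≤ r) :
    wn A r (∑ a : Fin A, C (x a) * X ^ (a : ℕ)) ≤ A * h * r ^ A := by
  unfold wn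
  calc _ ≤ ∑ a ∈ Finset.range A, h * r ^ A := by
        refine Finset.sum_le_sum fun a ha => ?_
        have ha' := Finset.mem_range.1 ha
        have h1 : (∑ b : Fin A, C (x b) * X ^ (b : ℕ)).coeff a = x ⟨a, ha'⟩ := by
          rw [finset_sum_coeff, Finset.sum_eq_single ⟨a, ha'⟩]
          · simp
          · intro b _ hb
            rw [coeff_C_mul, coeff_X_pow, if_neg, mul_zero]
            intro h; exact hb (Fin.ext h.symm)
          · simp
        rw [h1]
        have := hx ⟨a, ha'⟩
        have h2 : r ^ a ≤ r ^ A := pow_le_pow_right₀ hr ha'.le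
        gcongr
    _ = _ := by simp [mul_assoc]

lemma arith (K : Type) [Field K] [NumberField K] (ι : K →+* ℂ) : ∃ cS : ℝ, 1 ≤ cS ∧
    ∀ (Δ I Ps : Type) [Fintype Δ] [Fintype I] [Fintype Ps] [DecidableEq Δ] [DecidableEq I]
      [DecidableEq Ps] (A T : ℕ) (c : I → 𝓞 K) (e : I → Δ → 𝓞 K) (g : Ps → 𝓞 K)
      (V : Ps → Δ → 𝓞 K) (E : Ps → Δ → ℂ) (q : ℂ) (_ : q ≠ 0) (_ : 1 ≤ T)
      (_ : ∀ s δ, ι (V s δ) = q * Complex.exp (E s δ))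
      (M ρ v : ℝ) (_ : 1 ≤ M) (_ : 1 ≤ ρ) (_ : 1 ≤ v)
      (_ : ∀ τ : K →+* ℂ, ∀ i δ, ‖τ (c i)‖ * A + ‖τ (e i δ)‖ ≤ M)
      (_ : ∀ τ : K →+* ℂ, ∀ s, ‖τ (g s)‖ ≤ ρ)
      (_ : ∀ τ : K →+* ℂ, ∀ s δ, ‖τ (V s δ)‖ ≤ v)
      (_ : 2 * (T ^ Fintype.card I * Fintype.card Ps) ≤ A * Fintype.card Δ)
      (p0 : Ps) (_ : g p0 = 0) (_ : ∀ δ, E p0 δ = 0) (i0 : I) (_ : c i0 = 1)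
      (_ : Function.Injective (fun δ => ι (e i0 δ)))
      (Hξ : ℝ) (_ : Hξ = cS * (A * Fintype.card Δ) * (M ^ (Fintype.card I * T) * ρ ^ A * v)),
    ∃ P : Δ → ℂ[X], (∀ δ, P δ ∈ degreeLT ℂ A) ∧ (∀ δ (r : ℝ), 1 ≤ r → wn A r (P δ) ≤ A * Hξ * r ^ A) ∧
      ∃ m, T ≤ m ∧ (∀ s, ∀ l : List I, l.length < m →
        evf P (ι (g s)) (E s) (l.map (fun i δ => C (ι (c i)) * X + C (ι (e i δ)))).prod = 0) ∧
      ∃ s, ∃ l : List I, l.length = m ∧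
        1 ≤ ‖q‖ * ‖evf P (ι (g s)) (E s) (l.map (fun i δ => C (ι (c i)) * X + C (ι (e i δ)))).prod‖ *
          ((A * Fintype.card Δ) * (M ^ m * ρ ^ A * v) * Hξ) ^ (Module.finrank ℚ K - 1) := by
  obtain ⟨cS, hcS, hsiegel⟩ := siegel_K K
  refine ⟨cS, hcS, ?_⟩
  intro Δ I Ps _ _ _ _ _ _ A T c e g V E q hq hT hV M ρ v hM hρ hv hce hg hVb hcard p0 hg0 hE0 i0 hc0 hinj Hξ hHξ
  let emb : (K →+* ℂ) → (𝓞 K →+* ℂ) := fun τ => τ.comp (algebraMap (𝓞 K) K)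
  let th : I → Δ → (𝓞 K)[X] := fun i δ => C (c i) * X + C (e i δ)
  let Xop : I → Δ → ℂ[X] := fun i δ => C (ι (c i)) * X + C (ι (e i δ))
  have hmap : ∀ (τ : K →+* ℂ) (s : Ps) (l : List I) (a : ℕ) (δ : Δ),
      τ ((entry (fun i => th i δ) (g s) (V s δ) l a : 𝓞 K) : K) =
        entry (fun i => C (τ (c i)) * X + C (τ (e i δ))) (τ (g s)) (τ (V s δ)) l a := by
    intro τ s l a δ
    have := entry_map (emb τ) (fun i => th i δ) (g s) (V s δ) l a
    refine this.trans ?_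
    congr 1
    funext i
    simp [th, emb]
  have hbd : ∀ (s : Ps) (l : List I) (a : Fin A) (δ : Δ),
      house ((entry (fun i => th i δ) (g s) (V s δ) l a : 𝓞 K) : K) ≤ M ^ l.length * ρ ^ A * v := by
    intro s l a δ
    refine house_le_of K _ _ fun τ => ?_
    rw [hmap]
    exact entry_bound _ _ _ _ l A a a.2 M ρ v (by linarith) hρ (fun i => hce τ i δ) (hg τ s) (hVb τ s δ)
  choose lst hlst1 hlst2 using fun f : I → Fin T => exists_list_count (fun i => (f i : ℕ))
  let mat : Matrix ((I → Fin T) × Ps) (Fin A × Δ) (𝓞 K) := Matrix.of fun r p =>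
    entry (fun i => th i p.2) (g r.2) (V r.2 p.2) (lst r.1) p.1
  haveI : Nonempty Ps := ⟨p0⟩
  have hlen : ∀ f, (lst f).length ≤ Fintype.card I * T := by
    intro f
    rw [hlst2]
    calc _ ≤ ∑ i : I, T := Finset.sum_le_sum fun i _ => (f i).2.le
      _ = _ := by simp
  haveI : Nonempty (Fin T) := ⟨⟨0, hT⟩⟩
  obtain ⟨ξ, hξ0, hξ1, hξ2⟩ := hsiegel ((I → Fin T) × Ps) (Fin A × Δ) mat
    (M ^ (Fintype.card I * T) * ρ ^ A * v) (by
      have := one_le_pow₀ hM (n := Fintype.card I * T)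
      have := one_le_pow₀ hρ (n := A)
      exact one_le_mul_of_one_le_of_one_le (one_le_mul_of_one_le_of_one_le ‹_› ‹_›) hv)
    (by
      rintro ⟨f, s⟩ ⟨a, δ⟩
      refine (hbd s (lst f) a δ).trans ?_
      have := hlen f
      gcongr)
    (Fintype.card_pos) (by simpa [Fintype.card_prod] using hcard)
  have hHξ' : ∀ p, house (ξ p : K) ≤ Hξ := by
    intro p
    refine (hξ2 p).trans (le_of_eq ?_)
    rw [hHξ]; simp
  obtain ⟨p1, hp1⟩ := Function.ne_iff.1 hξ0
  have hHξ0 : 0 ≤ Hξ := (house_nonneg _).trans (hHξ' p1)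
  let P : Δ → ℂ[X] := fun δ => ∑ a : Fin A, C (ι (ξ (a, δ))) * X ^ (a : ℕ)
  -- key identity
  have hkey : ∀ s l, ι ((∑ p : Fin A × Δ, entry (fun i => th i p.2) (g s) (V s p.2) l p.1 * ξ p : 𝓞 K) : K)
      = q * evf P (ι (g s)) (E s) (l.map Xop).prod := by
    intro s l
    rw [← evf_entry A (fun p => ι (ξ p)) Xop (ι (g s)) q (fun δ => ι (V s δ)) (E s) (hV s) l]
    rw [oi_sum, map_sum]
    refine Finset.sum_congr rfl fun p _ => ?_
    rw [oi_mul, map_mul, hmap]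
  have hvanT : ∀ s, ∀ l : List I, l.length < T → evf P (ι (g s)) (E s) (l.map Xop).prod = 0 := by
    intro s l hl
    let f : I → Fin T := fun i => ⟨l.count i, lt_of_le_of_lt List.count_le_length hl⟩
    have h1 : ∀ {B : Type} [CommMonoid B] (y : I → B), (l.map y).prod = ((lst f).map y).prod := by
      intro B _ y
      rw [prod_eq_count, prod_eq_count]
      simp [hlst1, f]
    rw [h1]
    have h2 := hkey s (lst f)
    have h3 : (∑ p : Fin A × Δ, entry (fun i => th i p.2) (g s) (V s p.2) (lst f) p.1 * ξ p : 𝓞 K) = 0 :=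
      congrFun hξ1 (f, s)
    rw [h3] at h2
    simp only [map_zero] at h2
    exact (mul_eq_zero.1 h2.symm).resolve_left hq
  have hne : ∃ m, ∃ s, ∃ l : List I, l.length = m ∧ evf P (ι (g s)) (E s) (l.map Xop).prod ≠ 0 := by
    by_contra! hcon
    have hP : P = 0 := by
      apply exp_poly_indep (fun δ => ι (e i0 δ)) hinj P
      intro j
      have := hcon j p0 (List.replicate j i0) (by simp)
      rw [evf_apply] at this
      simpa [hg0, hE0, Xop, hc0] using this
    apply hp1
    have h1 : (P p1.2).coeff p1.1 = 0 := by rw [hP]; simp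
    have h2 : (P p1.2).coeff p1.1 = ι (ξ p1) := by
      simp only [P, finset_sum_coeff, coeff_C_mul, coeff_X_pow]
      rw [Finset.sum_eq_single p1.1]
      · simp
      · intro b _ hb
        rw [if_neg, mul_zero]
        intro h; exact hb (Fin.ext h.symm)
      · simp
    rw [h2] at h1
    have h3 := (map_eq_zero ι).1 h1
    exact_mod_cast h3
  classical
  let m := Nat.find hne
  obtain ⟨s, l, hl, hsl⟩ := Nat.find_spec hne
  have hmin : ∀ s, ∀ l : List I, l.length < m → evf P (ι (g s)) (E s) (l.map Xop).prod = 0 := by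
    intro s l hl
    by_contra h
    exact Nat.find_min hne hl ⟨s, l, rfl, h⟩
  refine ⟨P, ?_, ?_, m, ?_, hmin, s, l, hl, ?_⟩
  · intro δ
    refine Submodule.sum_mem _ fun a _ => ?_
    rw [mem_degreeLT]
    refine (degree_C_mul_X_pow_le _ _).trans_lt ?_
    exact_mod_cast a.2
  · intro δ r hr
    exact wn_sum_le A (fun a => ι (ξ (a, δ))) Hξ
      (fun a => (norm_embedding_le_house _ ι).trans (hHξ' _)) hHξ0 r hr
  · by_contra h
    exact hsl (hvanT s l (by omega))
  · set η : 𝓞 K := ∑ p : Fin A × Δ, entry (fun i => th i p.2) (g s) (V s p.2) l p.1 * ξ p with hη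
    have hη1 := hkey s l
    rw [← hη] at hη1
    have hη0 : η ≠ 0 := by
      intro h
      rw [h, oi_zero, map_zero] at hη1
      exact mul_ne_zero hq hsl hη1.symm
    have h1 := integer_lower K η hη0 ι
    rw [hη1, norm_mul] at h1
    refine h1.trans ?_
    have h2 : house (η : K) ≤ (A * Fintype.card Δ) * (M ^ m * ρ ^ A * v) * Hξ := by
      rw [hη, oi_sum]
      refine (house_sum_le_sum_house _ _).trans ?_
      calc _ ≤ ∑ p : Fin A × Δ, (M ^ m * ρ ^ A * v) * Hξ := by
            refine Finset.sum_le_sum fun p _ => ?_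
            rw [oi_mul]
            refine (house_mul_le _ _).trans ?_
            have := hbd s l p.1 p.2
            rw [hl] at this
            have := hHξ' p
            have := house_nonneg (ξ p : K)
            have : 0 ≤ M ^ m * ρ ^ A * v := by positivity
            gcongr
        _ = _ := by simp [mul_assoc]
    have := house_nonneg (η : K)
    gcongr
end PartE

section PartF
lemma gain (n S m e c : ℕ) (R : ℝ) (hS : S = 4 * n ^ 2 * c) (hS1 : 1 ≤ S) (hR : (4 * (S : ℝ)) ^ 2 ≤ R)
    (hRm : R ^ (2 * n) = m) (hm : 1 ≤ m) (he : m ≤ n * e) :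
    (4 * S / R) ^ (S * e) ≤ 1 / ((m : ℝ) ^ m) ^ c := by
  have hS' : (1 : ℝ) ≤ S := by exact_mod_cast hS1
  have hR0 : 0 < R := lt_of_lt_of_le (by positivity) hR
  have hm' : (1 : ℝ) ≤ m := by exact_mod_cast hm
  have h1 : (4 * S / R) ^ 2 ≤ 1 / R := by
    rw [div_pow, div_le_div_iff₀ (by positivity) hR0]
    nlinarith
  have h2 : S * e = 2 * (2 * n * ((n * e) * c)) := by rw [hS]; ring
  rw [h2, pow_mul]
  calc ((4 * S / R) ^ 2) ^ (2 * n * ((n * e) * c)) ≤ (1 / R) ^ (2 * n * ((n * e) * c)) := by gcongr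
    _ = (1 / (m : ℝ)) ^ ((n * e) * c) := by rw [pow_mul, div_pow, hRm, one_pow]
    _ ≤ (1 / (m : ℝ)) ^ (m * c) := by
        apply pow_le_pow_of_le_one (by positivity)
        · rw [div_le_one (by linarith)]; exact hm'
        · gcongr
    _ = _ := by rw [div_pow, one_pow, pow_mul]

lemma pow_le_y (m k : ℕ) (x : ℝ) (hm : 1 ≤ m) (hx0 : 0 ≤ x) (hx : x ≤ m) (hk : k ≤ m) : x ^ k ≤ (m : ℝ) ^ m := by
  have hm' : (1 : ℝ) ≤ m := by exact_mod_cast hm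
  calc x ^ k ≤ (m : ℝ) ^ k := by gcongr
    _ ≤ _ := pow_le_pow_right₀ hm' hk

lemma pow_le_y2 (m k : ℕ) (x : ℝ) (hm : 1 ≤ m) (hx0 : 0 ≤ x) (hx : x ≤ m ^ 2) (hk : k ≤ m) :
    x ^ k ≤ ((m : ℝ) ^ m) ^ 2 := by
  have hm' : (1 : ℝ) ≤ m := by exact_mod_cast hm
  calc x ^ k ≤ ((m : ℝ) ^ 2) ^ k := by gcongr
    _ ≤ ((m : ℝ) ^ 2) ^ m := pow_le_pow_right₀ (one_le_pow₀ hm') hk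
    _ = _ := by rw [← pow_mul, ← pow_mul, mul_comm]

set_option maxHeartbeats 1000000 in
/-- All the numerical bounds. -/
lemma numerics (n c S X m A B : ℕ) (κ R M ρ₀ v q cS Cc M₁ ρ e₀ Hξ : ℝ) (hn : 1 ≤ n) (hc : 1 ≤ c)
    (hS : S = 4 * n ^ 2 * c) (hX1 : (4 * S) ^ 2 ≤ X) (hX2 : 2 * κ ≤ X) (hX3 : Real.exp κ ≤ X)
    (hX4 : 2 * S ^ n ≤ X) (hX5 : n + 1 ≤ X) (hm : X ^ (2 * n) ≤ m)
    (hA : A = 2 * S ^ n * X ^ n) (hB : B = X ^ (2 * n - 1)) (hR0 : 0 ≤ R) (hR : R ^ (2 * n) = m)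
    (hκ : 1 ≤ κ) (hM0 : 0 ≤ M) (hM : M ≤ κ * (A + B)) (hρ₀0 : 0 ≤ ρ₀) (hρ₀ : ρ₀ ≤ κ) (hv0 : 0 ≤ v) (hv : v ≤ κ ^ B)
    (hq0 : 0 ≤ q) (hq : q ≤ κ ^ B) (hcS0 : 0 ≤ cS) (hcS : cS ≤ κ) (hCc0 : 0 ≤ Cc) (hCc : Cc ≤ κ)
    (hM₁0 : 0 ≤ M₁) (hM₁ : M₁ ≤ κ * (A + B)) (hρ0 : 0 ≤ ρ) (hρ : ρ ≤ κ * R) (he₀ : (n + 1) * R * e₀ ≤ κ * R * B)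
    (card : ℝ) (hcard : card = B ^ n) (cI : ℕ) (hcI : cI ≤ n)
    (hHξ : Hξ = cS * (A * card) * (M ^ (cI * X ^ (2 * n)) * ρ₀ ^ A * v)) :
    ∃ D : ℝ, 0 ≤ D ∧ 4 * (S : ℝ) ≤ R ∧ 1 ≤ R ∧ (∀ e ≤ m, m ≤ n * e →
      e.factorial * (card * (M₁ ^ (m - e) * (A * Hξ * ρ ^ A) *
        Real.exp ((n + 1) * R * e₀)) * (4 * S / R) ^ (S * e)) ≤ D) ∧
      (c = 2 * n + 15 + (2 * n + 9) * (n - 1) → 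
        q * (Cc ^ m * D) * (A * card * (M ^ m * ρ₀ ^ A * v) * Hξ) ^ (n - 1) < 1) := by
  have hX1' : (1 : ℝ) ≤ X := by
    have : (1 : ℝ) ≤ n := by exact_mod_cast hn
    have h : ((n + 1 : ℕ) : ℝ) ≤ X := by exact_mod_cast hX5
    push_cast at h; linarith
  have hXn : 1 ≤ X := by exact_mod_cast hX1'
  have hS1 : 1 ≤ S := by rw [hS]; have : 1 ≤ n ^ 2 := Nat.one_le_pow _ _ hn; nlinarith
  have hS' : (1 : ℝ) ≤ S := by exact_mod_cast hS1
  have hXm : X ≤ m := le_trans (Nat.le_self_pow (by omega) X) hm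
  have hm1 : 1 ≤ m := hXn.trans hXm
  have hm' : (1 : ℝ) ≤ m := by exact_mod_cast hm1
  have hXm' : (X : ℝ) ≤ m := by exact_mod_cast hXm
  have hAm : A ≤ m := by
    rw [hA]
    refine le_trans ?_ hm
    calc 2 * S ^ n * X ^ n ≤ X * X ^ n := by gcongr
      _ = X ^ (n + 1) := by ring
      _ ≤ X ^ (2 * n) := Nat.pow_le_pow_right hXn (by omega)
  have hBm : B ≤ m := by
    rw [hB]; exact le_trans (Nat.pow_le_pow_right hXn (by omega)) hm
  have hXR : (X : ℝ) ≤ R := by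
    refine le_of_pow_le_pow_left₀ (n := 2 * n) (by omega) hR0 ?_
    rw [hR]; exact_mod_cast hm
  have hR1 : 1 ≤ R := hX1'.trans hXR
  have hRm : R ≤ m := by
    rw [← hR]; exact le_self_pow₀ hR1 (by omega)
  have hBR : R * B ≤ m := by
    obtain ⟨k, hk⟩ : ∃ k, 2 * n = k + 1 := ⟨2 * n - 1, by omega⟩
    rw [← hR, hB, hk, pow_succ, Nat.add_sub_cancel]
    push_cast
    rw [mul_comm]
    gcongr
  have hX1r : (4 * (S : ℝ)) ^ 2 ≤ X := by exact_mod_cast hX1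
  have h4SR : 4 * (S : ℝ) ≤ R := by nlinarith
  have hAm' : (A : ℝ) ≤ m := by exact_mod_cast hAm
  have hBm' : (B : ℝ) ≤ m := by exact_mod_cast hBm
  have hκm : κ ≤ m := by linarith
  have hgain := fun e he2 => gain n S m e c R hS hS1 (hX1r.trans hXR) hR hm1 he2
  have hpy := pow_le_y m
  have hpy2 := pow_le_y2 m
  have hmy : (m : ℝ) ≤ (m : ℝ) ^ m := le_self_pow₀ hm' (by omega)
  obtain ⟨y, hy⟩ : ∃ y : ℝ, y = (m : ℝ) ^ m := ⟨_, rfl⟩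
  simp only [← hy] at hgain hpy hpy2 hmy
  have hy1 : 1 ≤ y := hm'.trans hmy
  have hy0 : 0 ≤ y := by linarith
  have hsum : κ * (A + B) ≤ (m : ℝ) ^ 2 := by nlinarith
  have hMk : ∀ k ≤ m, M ^ k ≤ y ^ 2 := fun k hk => hpy2 k M hm1 hM0 (hM.trans hsum) hk
  have hM1k : ∀ k ≤ m, M₁ ^ k ≤ y ^ 2 := fun k hk => hpy2 k M₁ hm1 hM₁0 (hM₁.trans hsum) hk
  have hκ0 : 0 ≤ κ := by linarith
  have hκB : κ ^ B ≤ y := hpy B κ hm1 hκ0 hκm hBm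
  have hvy : v ≤ y := hv.trans hκB
  have hqy : q ≤ y := hq.trans hκB
  have hρ₀y : ρ₀ ^ A ≤ y := hpy A ρ₀ hm1 hρ₀0 (hρ₀.trans hκm) hAm
  have hnm : n ≤ m := by omega
  have hcy : card ≤ y := by rw [hcard]; exact hpy n B hm1 (by positivity) hBm' hnm
  have hcard0 : 0 ≤ card := by rw [hcard]; positivity
  have hAcy : A * card ≤ y := by
    have : (A : ℝ) * card ≤ (m : ℝ) ^ (n + 1) := by
      rw [hcard, pow_succ, mul_comm]; gcongr
    exact this.trans (hpy (n + 1) m hm1 (by positivity) le_rfl (by omega))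
  have hMT : M ^ (cI * X ^ (2 * n)) ≤ y ^ (2 * n) := by
    rw [mul_comm cI, pow_mul]
    calc (M ^ (X ^ (2 * n))) ^ cI ≤ (y ^ 2) ^ cI := by gcongr; exact hMk _ hm
      _ ≤ (y ^ 2) ^ n := pow_le_pow_right₀ (one_le_pow₀ hy1) hcI
      _ = _ := by rw [← pow_mul]
  have hHy : Hξ ≤ y ^ (2 * n + 4) := by
    rw [hHξ]
    calc cS * (A * card) * (M ^ (cI * X ^ (2 * n)) * ρ₀ ^ A * v) ≤ y * y * (y ^ (2 * n) * y * y) := by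
          gcongr; exact hcS.trans (hκm.trans hmy)
      _ = _ := by ring
  have hH0 : 0 ≤ Hξ := by rw [hHξ]; positivity
  have hηy : A * card * (M ^ m * ρ₀ ^ A * v) * Hξ ≤ y ^ (2 * n + 9) := by
    calc A * card * (M ^ m * ρ₀ ^ A * v) * Hξ ≤ y * (y ^ 2 * y * y) * y ^ (2 * n + 4) := by
          gcongr; exact hMk m le_rfl
      _ = _ := by ring
  have hρA : ρ ^ A ≤ y ^ 2 := by
    refine hpy2 A ρ hm1 hρ0 ?_ hAm
    calc ρ ≤ κ * R := hρ
      _ ≤ m * m := by gcongr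
      _ = _ := by ring
  have hexp : Real.exp ((n + 1) * R * e₀) ≤ y := by
    calc _ ≤ Real.exp (κ * m) := by
          apply Real.exp_le_exp.2
          refine he₀.trans ?_
          rw [mul_assoc]; gcongr
      _ = Real.exp κ ^ m := by rw [mul_comm, Real.exp_nat_mul]
      _ ≤ y := hpy m _ hm1 (Real.exp_pos _).le (hX3.trans hXm') le_rfl
  have hy00 : 0 < y := by linarith
  refine ⟨y ^ (2 * n + 12) * (1 / y ^ c), by positivity, h4SR, hR1, ?_, ?_⟩
  · intro e he1 he2
    have hg := hgain e he2
    have hfac : (e.factorial : ℝ) ≤ y := by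
      have h1 : (e.factorial : ℝ) ≤ (e : ℝ) ^ e := by exact_mod_cast Nat.factorial_le_pow e
      refine h1.trans (hpy e e hm1 (by positivity) (by exact_mod_cast he1) he1)
    have hAy : (A : ℝ) ≤ y := hAm'.trans hmy
    have hM2 := hM1k (m - e) (by omega)
    have hg0 : 0 ≤ (4 * S / R) ^ (S * e) := by positivity
    have hz : 0 ≤ 1 / y ^ c := by positivity
    have hM20 : 0 ≤ M₁ ^ (m - e) := by positivity
    have hx0 := (Real.exp_pos ((n + 1) * R * e₀)).le
    have hρA0 : 0 ≤ ρ ^ A := by positivity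
    generalize (4 * S / R) ^ (S * e) = g at hg hg0 ⊢
    generalize 1 / y ^ c = z at hg hz ⊢
    generalize M₁ ^ (m - e) = z2 at hM2 hM20 ⊢
    generalize Real.exp ((n + 1) * R * e₀) = z3 at hexp hx0 ⊢
    generalize ρ ^ A = z4 at hρA hρA0 ⊢
    calc _ ≤ y * (y * (y ^ 2 * (y * y ^ (2 * n + 4) * y ^ 2) * y) * z) := by
          gcongr
      _ = _ := by ring
  · intro hcc
    have hCcm : Cc ^ m ≤ y := hpy m Cc hm1 hCc0 (hCc.trans hκm) le_rfl
    have hη0 : 0 ≤ A * card * (M ^ m * ρ₀ ^ A * v) * Hξ := by positivity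
    have hη1 := pow_le_pow_left₀ hη0 hηy (n - 1)
    have hη2 := pow_nonneg hη0 (n - 1)
    have hC2 := pow_nonneg hCc0 m
    calc _ ≤ y * (y * (y ^ (2 * n + 12) * (1 / y ^ c))) * (y ^ (2 * n + 9)) ^ (n - 1) := by
          refine mul_le_mul ?_ hη1 hη2 (by positivity)
          refine mul_le_mul hqy ?_ (by positivity) hy0
          exact mul_le_mul_of_nonneg_right hCcm (by positivity)
      _ = y ^ (2 * n + 14 + (2 * n + 9) * (n - 1)) / y ^ c := by rw [← pow_mul]; ring
      _ = 1 / y := by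
          rw [hcc]
          rw [show 2 * n + 15 + (2 * n + 9) * (n - 1) = (2 * n + 14 + (2 * n + 9) * (n - 1)) + 1 by ring,
            pow_succ]
          field_simp
      _ < 1 := by
          rw [div_lt_one hy00]
          have : (2 : ℝ) ≤ X := by
            have h : ((n + 1 : ℕ) : ℝ) ≤ X := by exact_mod_cast hX5
            have : (1 : ℝ) ≤ n := by exact_mod_cast hn
            push_cast at h; linarith
          linarith
end PartF

section PartG
open Polynomial NumberField

/-- the additive map chi -/
noncomputable def chiHom {K : Type} [Field K] [NumberField K] (ι : K →+* ℂ) (ω : Gal(K/ℚ) → ℂ) :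
    𝓞 K →+ ℂ where
  toFun x := ∑ σ : Gal(K/ℚ), ι (σ (x : K)) * ω σ
  map_zero' := by simp
  map_add' x y := by simp [add_mul, Finset.sum_add_distrib]

lemma chiHom_apply {K : Type} [Field K] [NumberField K] (ι : K →+* ℂ) (ω : Gal(K/ℚ) → ℂ) (x : 𝓞 K) :
    chiHom ι ω x = ∑ σ : Gal(K/ℚ), ι (σ (x : K)) * ω σ := rfl

lemma sum_subtype_ne {G : Type*} [Fintype G] (ω : G → ℂ) [Fintype {σ // ω σ ≠ 0}] (f : G → ℂ)
    (h : ∀ σ, ω σ = 0 → f σ = 0) : ∑ i : {σ // ω σ ≠ 0}, f i = ∑ σ, f σ := by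
  classical
  rw [← Finset.sum_filter_add_sum_filter_not Finset.univ (fun σ => ω σ ≠ 0)]
  rw [Finset.sum_eq_zero (s := Finset.univ.filter (fun σ => ¬ ω σ ≠ 0)), add_zero]
  · rw [← Finset.sum_subtype (Finset.univ.filter (fun σ => ω σ ≠ 0)) (by simp)]
  · intro σ hσ
    simp at hσ
    exact h σ hσ

open Classical in
lemma ops {K : Type} [Field K] [NumberField K] [IsGalois ℚ K] (ι : K →+* ℂ)
    (ω : Gal(K/ℚ) → ℂ) (N : ℤ) (hω : ω 1 = N) {J Δ : Type} [Fintype J] [DecidableEq J]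
    (b : J → 𝓞 K) (cd : Gal(K/ℚ) → J → ℂ)
    (hcd : ∀ σ τ : Gal(K/ℚ), ∑ k, cd σ k * ι (τ (b k : K)) = if σ = τ then 1 else 0)
    (d : Δ → 𝓞 K)
    (Xop : {σ : Gal(K/ℚ) // ω σ ≠ 0} → Δ → ℂ[X])
    (hXop : ∀ i δ, Xop i δ = C (if i.1 = 1 then 1 else 0) * X + C (ι (i.1 (d δ : K))))
    (Yop : J → Δ → ℂ[X])
    (hYop : ∀ k δ, Yop k δ = C ((N : ℂ) * ι (b k)) * X + C (chiHom ι ω (d δ * b k))) :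
    (∀ i, Xop i = ∑ k, ((ω i.1)⁻¹ * cd i.1 k) • Yop k) ∧
    (∀ k, Yop k = ∑ i : {σ : Gal(K/ℚ) // ω σ ≠ 0}, (ι (i.1 (b k : K)) * ω i.1) • Xop i) := by
  constructor
  · intro i
    funext δ
    rw [Finset.sum_apply]
    simp only [Pi.smul_apply, hXop, hYop, smul_eq_C_mul, mul_add, ← mul_assoc, ← C_mul,
      Finset.sum_add_distrib, ← Finset.sum_mul]
    rw [← map_sum C, ← map_sum C]
    congr 3
    · have h := hcd i.1 1
      calc _ = (ω i.1)⁻¹ * N * ∑ k, cd i.1 k * ι ((1 : Gal(K/ℚ)) (b k : K)) := by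
            rw [h]
            split_ifs with h1
            · rw [h1, hω]; field_simp
              have := i.2; rw [h1, hω] at this; rw [div_self this]
            · simp
        _ = _ := by
            rw [Finset.mul_sum]
            refine Finset.sum_congr rfl fun k _ => ?_
            simp; ring
    · calc _ = ∑ τ : Gal(K/ℚ), (ω i.1)⁻¹ * ω τ * ι (τ (d δ : K)) *
              ∑ k, cd i.1 k * ι (τ (b k : K)) := by
            simp only [hcd]
            simp [inv_mul_cancel₀ i.2]
        _ = _ := by
            simp only [chiHom_apply, Finset.mul_sum]
            rw [Finset.sum_comm]
            refine Finset.sum_congr rfl fun k _ => Finset.sum_congr rfl fun τ _ => ?_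
            rw [oi_mul, map_mul, map_mul]; ring
  · intro k
    funext δ
    rw [Finset.sum_apply]
    simp only [Pi.smul_apply, hXop, hYop, smul_eq_C_mul, mul_add, ← mul_assoc, ← C_mul,
      Finset.sum_add_distrib, ← Finset.sum_mul]
    rw [← map_sum C, ← map_sum C]
    congr 3
    · rw [sum_subtype_ne ω (fun i => ι (i (b k : K)) * ω i * if i = 1 then 1 else 0)
        (by intro σ h; simp [h])]
      simp [hω, mul_comm]
    · rw [sum_subtype_ne ω (fun i => ι (i (b k : K)) * ω i * ι (i (d δ : K)))
        (by intro σ h; simp [h])]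
      rw [chiHom_apply]
      refine Finset.sum_congr rfl fun τ _ => ?_
      rw [oi_mul, map_mul, map_mul]; ring
end PartG

section PartH
open Polynomial NumberField

lemma exists_bd {F : Type*} [Finite F] (f : F → ℝ) : ∃ c : ℝ, 0 ≤ c ∧ ∀ i, f i ≤ c := by
  obtain ⟨c, hc⟩ := Finite.exists_le f
  exact ⟨max 0 c, le_max_left _ _, fun i => (hc i).trans (le_max_right _ _)⟩

lemma denoms {K : Type} [Field K] [NumberField K] (ι : K →+* ℂ) {F : Type} [Finite F] (x : F → ℂ)
    (hx : ∀ i, ∃ u : K, ι u = x i) : ∃ Q : 𝓞 K, Q ≠ 0 ∧ ∃ U : F → 𝓞 K, ∀ i, ι (U i) = ι Q * x i := by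
  choose u hu using hx
  obtain ⟨Q, hQ⟩ := IsLocalization.exist_integer_multiples_of_finite (nonZeroDivisors (𝓞 K)) u
  refine ⟨Q, nonZeroDivisors.ne_zero Q.2, ?_⟩
  choose U hU using hQ
  refine ⟨U, fun i => ?_⟩
  have h := hU i
  rw [Algebra.smul_def] at h
  rw [← hu, ← map_mul]
  congr 1

/-- integer combination of the basis -/
noncomputable def comb {K : Type} [Field K] {J : Type} [Fintype J] (b : J → 𝓞 K) (S : ℕ) (s : J → Fin S) : 𝓞 K :=
  ∑ k, ((s k : ℕ) : 𝓞 K) * b k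

lemma comb_emb {K : Type} [Field K] {J : Type} [Fintype J] (b : J → 𝓞 K) (S : ℕ) (s : J → Fin S)
    (τ : K →+* ℂ) : τ (comb b S s) = ∑ k, ((s k : ℕ) : ℂ) * τ (b k) := by
  unfold comb
  rw [oi_sum, map_sum]
  refine Finset.sum_congr rfl fun k _ => ?_
  rw [oi_mul, map_mul]
  congr 1
  have : (((s k : ℕ) : 𝓞 K) : K) = ((s k : ℕ) : K) := map_natCast (algebraMap (𝓞 K) K) _
  rw [this, map_natCast]

lemma comb_bound {K : Type} [Field K] {J : Type} [Fintype J] (b : J → 𝓞 K) (S : ℕ) (s : J → Fin S)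
    (τ : K →+* ℂ) (β : ℝ) (hβ0 : 0 ≤ β) (hβ : ∀ k, ‖τ (b k)‖ ≤ β) :
    ‖τ (comb b S s)‖ ≤ Fintype.card J * S * β := by
  rw [comb_emb]
  exact norm_comb_le (fun k => (s k : ℕ)) S (fun k => (s k).2.le) _ β hβ hβ0

lemma hom_comb {K : Type} [Field K] {J : Type} [Fintype J] (b : J → 𝓞 K) (S : ℕ) (s : J → Fin S)
    (f : 𝓞 K →+ ℂ) (x : 𝓞 K) : f (comb b S s * x) = ∑ k, ((s k : ℕ) : ℂ) * f (b k * x) := by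
  unfold comb
  rw [Finset.sum_mul, map_sum]
  refine Finset.sum_congr rfl fun k _ => ?_
  rw [mul_assoc, ← nsmul_eq_mul, map_nsmul, nsmul_eq_mul]

lemma comb_inj {K : Type} [Field K] [NumberField K] {J : Type} [Fintype J] (b : Module.Basis J ℤ (𝓞 K)) (S : ℕ) :
    Function.Injective (comb b S) := by
  intro s t h
  unfold comb at h
  have h1 : ∀ s : J → Fin S, b.repr (∑ k, ((s k : ℕ) : 𝓞 K) * b k) = b.repr (∑ k, ((s k : ℕ) : ℤ) • b k) := by
    intro s; congr 1
    refine Finset.sum_congr rfl fun k _ => ?_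
    simp
  have h2 := congrArg b.repr h
  rw [h1, h1] at h2
  funext k
  have h3 := DFunLike.congr_fun h2 k
  rw [b.repr_sum_self, b.repr_sum_self] at h3
  exact Fin.ext (by exact_mod_cast h3)
end PartH

section PartI
open Polynomial NumberField

lemma V_val {K : Type} [Field K] [NumberField K] (ι : K →+* ℂ) {J : Type} [Fintype J] (b : J → 𝓞 K)
    (S B : ℕ) (f : 𝓞 K →+ ℂ) (Q : 𝓞 K) (U : J × (J → Fin S) → 𝓞 K)
    (hU : ∀ p, ι (U p) = ι Q * Complex.exp (f (b p.1 * comb b S p.2))) (s : J → Fin S) (δ : J → Fin B) :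
    ι ((∏ k, U (k, s) ^ (δ k : ℕ) * Q ^ (B - (δ k : ℕ)) : 𝓞 K) : K) =
      (ι Q ^ B) ^ Fintype.card J * Complex.exp (∑ k, ((s k : ℕ) : ℂ) * f (comb b B δ * b k)) := by
  have h0 : ∑ k, ((s k : ℕ) : ℂ) * f (comb b B δ * b k) =
      ∑ k, ((δ k : ℕ) : ℂ) * f (b k * comb b S s) := by
    rw [← hom_comb b B δ f, mul_comm, hom_comb b S s f]
    refine Finset.sum_congr rfl fun k _ => ?_
    rw [mul_comm (b k)]
  rw [h0, Complex.exp_sum]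
  have h1 : ((∏ k, U (k, s) ^ (δ k : ℕ) * Q ^ (B - (δ k : ℕ)) : 𝓞 K) : K) =
      ∏ k, (U (k, s) : K) ^ (δ k : ℕ) * (Q : K) ^ (B - (δ k : ℕ)) := by
    have := map_prod (algebraMap (𝓞 K) K) (fun k => U (k, s) ^ (δ k : ℕ) * Q ^ (B - (δ k : ℕ))) Finset.univ
    refine this.trans (Finset.prod_congr rfl fun k _ => ?_)
    rw [map_mul, map_pow, map_pow]
  rw [h1, map_prod, ← Finset.card_univ, ← Finset.prod_const, ← Finset.prod_mul_distrib]
  refine Finset.prod_congr rfl fun k _ => ?_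
  rw [map_mul, map_pow, map_pow, hU, mul_pow, Complex.exp_nat_mul]
  rw [mul_right_comm, ← pow_add, Nat.add_sub_cancel' (δ k).2.le]

lemma V_bound {K : Type} [Field K] [NumberField K] (τ : K →+* ℂ) {J : Type} [Fintype J]
    (S B : ℕ) (Q : 𝓞 K) (U : J × (J → Fin S) → 𝓞 K) (u : ℝ) (hu : 1 ≤ u)
    (hU : ∀ p, ‖τ (U p)‖ ≤ u) (hQ : ‖τ Q‖ ≤ u) (s : J → Fin S) (δ : J → Fin B) :
    ‖τ ((∏ k, U (k, s) ^ (δ k : ℕ) * Q ^ (B - (δ k : ℕ)) : 𝓞 K) : K)‖ ≤ (u ^ Fintype.card J) ^ B := by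
  have h1 : ((∏ k, U (k, s) ^ (δ k : ℕ) * Q ^ (B - (δ k : ℕ)) : 𝓞 K) : K) =
      ∏ k, (U (k, s) : K) ^ (δ k : ℕ) * (Q : K) ^ (B - (δ k : ℕ)) := by
    have := map_prod (algebraMap (𝓞 K) K) (fun k => U (k, s) ^ (δ k : ℕ) * Q ^ (B - (δ k : ℕ))) Finset.univ
    refine this.trans (Finset.prod_congr rfl fun k _ => ?_)
    rw [map_mul, map_pow, map_pow]
  rw [h1, map_prod, norm_prod, ← pow_mul, mul_comm, pow_mul, ← Finset.card_univ, ← Finset.prod_const]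
  refine Finset.prod_le_prod (fun _ _ => norm_nonneg _) fun k _ => ?_
  rw [map_mul, map_pow, map_pow, norm_mul, norm_pow, norm_pow]
  have h2 := hU (k, s)
  calc _ ≤ u ^ (δ k : ℕ) * u ^ (B - (δ k : ℕ)) := by gcongr
    _ = _ := by rw [← pow_add, Nat.add_sub_cancel' (δ k).2.le]

set_option maxHeartbeats 2000000 in
open Classical in
theorem core (K : Type) [Field K] [NumberField K] [IsGalois ℚ K] (ι : K →+* ℂ) (ω : Gal(K/ℚ) → ℂ)
    (N : ℤ) (hN : N ≠ 0) (hω : ω 1 = N)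
    (hχ : ∀ x : 𝓞 K, ∃ u : K, ι u = Complex.exp (chiHom ι ω x)) : False := by
  set n := Module.finrank ℚ K with hn_def
  have hn : 1 ≤ n := Module.finrank_pos
  let J : Type := Module.Free.ChooseBasisIndex ℤ (𝓞 K)
  let b : Module.Basis J ℤ (𝓞 K) := RingOfIntegers.basis K
  have hJ : Fintype.card J = n := (Module.finrank_eq_card_basis (integralBasis K)).symm
  haveI : Nonempty J := Fintype.card_pos_iff.1 (by omega)
  obtain ⟨cd, hcd'⟩ := dual_matrix K ι (integralBasis K)
  have hcd : ∀ σ τ : Gal(K/ℚ), ∑ k, cd σ k * ι (τ (b k : K)) = if σ = τ then 1 else 0 := by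
    intro σ τ
    rw [← hcd' σ τ]
    simp only [integralBasis_apply]
    rfl
  let I : Type := {σ : Gal(K/ℚ) // ω σ ≠ 0}
  let i0 : I := ⟨1, by rw [hω]; exact_mod_cast hN⟩
  have hI : Fintype.card I ≤ n := by
    refine (Fintype.card_subtype_le _).trans ?_
    rw [← Nat.card_eq_fintype_card, IsGalois.card_aut_eq_finrank]
  obtain ⟨c, hc⟩ : ∃ c, c = 2 * n + 15 + (2 * n + 9) * (n - 1) := ⟨_, rfl⟩
  obtain ⟨S, hS⟩ : ∃ S, S = 4 * n ^ 2 * c := ⟨_, rfl⟩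
  have hc1 : 1 ≤ c := by rw [hc]; omega
  have hS1 : 1 ≤ S := by rw [hS]; have : 1 ≤ n ^ 2 := Nat.one_le_pow _ _ hn; nlinarith
  set χ := chiHom ι ω with hχdef
  obtain ⟨Q, hQ0, U, hU⟩ := denoms ι (fun p : J × (J → Fin S) => Complex.exp (χ (b p.1 * comb b S p.2)))
    (fun p => hχ _)
  obtain ⟨cS, hcS, harith⟩ := arith K ι
  -- constants
  obtain ⟨β, hβ0, hβ'⟩ := exists_bd (fun p : (K →+* ℂ) × J => ‖p.1 (b p.2)‖)
  have hβ : ∀ (τ : K →+* ℂ) k, ‖τ (b k)‖ ≤ β := fun τ k => hβ' (τ, k)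
  obtain ⟨u₁, hu₁0, hu₁⟩ := exists_bd (fun p : (K →+* ℂ) × (J × (J → Fin S)) => ‖p.1 (U p.2)‖)
  obtain ⟨u₂, hu₂0, hu₂⟩ := exists_bd (fun τ : (K →+* ℂ) => ‖τ Q‖)
  obtain ⟨u, hu⟩ : ∃ u, u = 1 + u₁ + u₂ := ⟨_, rfl⟩
  have hu1 : 1 ≤ u := by rw [hu]; linarith
  obtain ⟨x₀, hx₀0, hx₀'⟩ := exists_bd (fun p : J × J => ‖χ (b p.1 * b p.2)‖)
  have hx₀ : ∀ j k, ‖χ (b j * b k)‖ ≤ x₀ := fun j k => hx₀' (j, k)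
  obtain ⟨Cc, hCc0, hCc⟩ := exists_bd (fun i : I => ∑ k, ‖(ω i.1)⁻¹ * cd i.1 k‖)
  obtain ⟨ρ₀, hρ₀⟩ : ∃ ρ₀ : ℝ, ρ₀ = 1 + |(N : ℝ)| * (n * S * β) := ⟨_, rfl⟩
  have hρ₀1 : 1 ≤ ρ₀ := by rw [hρ₀]; have : 0 ≤ |(N : ℝ)| * (n * S * β) := by positivity
                           linarith
  obtain ⟨w, hw⟩ : ∃ w : ℝ, w = |(N : ℝ)| * β := ⟨_, rfl⟩
  have hw0 : 0 ≤ w := by rw [hw]; positivity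
  obtain ⟨κ, hκ⟩ : ∃ κ : ℝ, κ = ρ₀ + n * β + u ^ n + cS + Cc + (n + 1) * w + (n + 1) * n * x₀ := ⟨_, rfl⟩
  have k1 : 0 ≤ n * β := by positivity
  have k2 : 0 ≤ u ^ n := by positivity
  have k3 : 0 ≤ (n + 1) * w := by positivity
  have k4 : 0 ≤ (n + 1) * n * x₀ := by positivity
  have k5 : w ≤ (n + 1) * w := by nlinarith
  have k6 : n * x₀ ≤ (n + 1) * n * x₀ := by
    have : 0 ≤ n * x₀ := by positivity
    have : 0 ≤ (n : ℝ) := by positivity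
    nlinarith
  have hκ1 : 1 ≤ κ := by linarith
  have hκ0 : 0 ≤ κ := by linarith
  obtain ⟨X₀, hX₀⟩ := exists_nat_ge (max (2 * κ) (Real.exp κ))
  obtain ⟨Y, hY⟩ : ∃ Y : ℕ, Y = X₀ + (4 * S) ^ 2 + 2 * S ^ n + n + 1 := ⟨_, rfl⟩
  have hX₀Y : (X₀ : ℝ) ≤ Y := by exact_mod_cast (by omega)
  have hX2 : 2 * κ ≤ Y := (le_max_left _ _).trans (hX₀.trans hX₀Y)
  have hX3 : Real.exp κ ≤ Y := (le_max_right _ _).trans (hX₀.trans hX₀Y)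
  obtain ⟨A, hA⟩ : ∃ A, A = 2 * S ^ n * Y ^ n := ⟨_, rfl⟩
  obtain ⟨B, hB⟩ : ∃ B, B = Y ^ (2 * n - 1) := ⟨_, rfl⟩
  have hY1 : 1 ≤ Y := by omega
  have hA1 : 1 ≤ A := by rw [hA]; exact Nat.one_le_iff_ne_zero.2 (by positivity)
  have hA1' : (1 : ℝ) ≤ A := by exact_mod_cast hA1
  let Δ : Type := J → Fin B
  let d : Δ → 𝓞 K := comb b B
  let e : I → Δ → 𝓞 K := fun i δ => RingOfIntegers.mapRingHom (i.1 : K →+* K) (d δ)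
  let cc : I → 𝓞 K := fun i => if i = i0 then 1 else 0
  let g : (J → Fin S) → 𝓞 K := fun s => N * comb b S s
  let V : (J → Fin S) → Δ → 𝓞 K := fun s δ => ∏ k, U (k, s) ^ (δ k : ℕ) * Q ^ (B - (δ k : ℕ))
  let E₁ : J → Δ → ℂ := fun k δ => χ (d δ * b k)
  let E : (J → Fin S) → Δ → ℂ := fun s δ => ∑ k, ((s k : ℕ) : ℂ) * E₁ k δ
  have hιQ : ι Q ≠ 0 := by
    rw [Ne, map_eq_zero]
    exact fun h => hQ0 (by exact_mod_cast h)
  have he_val : ∀ (τ : K →+* ℂ) i δ, τ (e i δ) = (τ.comp (i.1 : K →+* K)) (d δ) := fun _ _ _ => rfl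
  have hg_val : ∀ (τ : K →+* ℂ) s, τ (g s) = N * τ (comb b S s) := by
    intro τ s
    simp only [g]
    rw [oi_mul, map_mul]
    congr 1
    have : ((N : 𝓞 K) : K) = (N : K) := map_intCast (algebraMap (𝓞 K) K) N
    rw [this, map_intCast]
  have hcardΔ : (Fintype.card Δ : ℝ) = (B : ℝ) ^ n := by
    simp only [Δ, Fintype.card_fun, Fintype.card_fin, hJ]; push_cast; rfl
  obtain ⟨M, hM⟩ : ∃ M : ℝ, M = A + n * B * β := ⟨_, rfl⟩
  have hnBβ : 0 ≤ n * B * β := by positivity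
  obtain ⟨Hξ, hHξ⟩ : ∃ Hξ : ℝ, Hξ = cS * (A * Fintype.card Δ) *
    (M ^ (Fintype.card I * Y ^ (2 * n)) * ρ₀ ^ A * (u ^ n) ^ B) := ⟨_, rfl⟩
  obtain ⟨P, hPdeg, hPwn, m, hTm, hvan, s, l, hl, hlow⟩ := harith Δ I (J → Fin S) A (Y ^ (2 * n)) cc e g V E
    ((ι Q ^ B) ^ Fintype.card J) (by positivity) (Nat.one_le_pow _ _ hY1)
    (fun s δ => V_val ι b S B χ Q U hU s δ) M ρ₀ ((u ^ n) ^ B) (by linarith) hρ₀1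
    (one_le_pow₀ (one_le_pow₀ hu1))
    (by
      intro τ i δ
      have h1 : ‖τ (cc i)‖ ≤ 1 := by
        simp only [cc]; split_ifs
        · have : ((1 : 𝓞 K) : K) = 1 := rfl
          simp [this]
        · simp [oi_zero]
      have h2 := comb_bound b B δ (τ.comp (i.1 : K →+* K)) β hβ0 (fun k => hβ _ k)
      rw [hJ] at h2
      rw [he_val, hM]
      refine add_le_add ?_ h2
      calc _ ≤ (1 : ℝ) * A := by gcongr
        _ = A := one_mul _)
    (by
      intro τ s
      have h2 := comb_bound b S s τ β hβ0 (fun k => hβ _ k)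
      rw [hJ] at h2
      rw [hg_val, norm_mul, Complex.norm_intCast, hρ₀]
      have : |(N : ℝ)| * ‖τ (comb b S s)‖ ≤ |(N : ℝ)| * (n * S * β) := by gcongr
      linarith)
    (by
      intro τ s δ
      have := V_bound τ S B Q U u hu1 (fun p => by rw [hu]; have := hu₁ (τ, p); simp only at this; linarith)
        (by rw [hu]; have := hu₂ τ; linarith) s δ
      rwa [hJ] at this)
    (by
      simp only [Δ, Fintype.card_fun, Fintype.card_fin, hJ]
      calc 2 * ((Y ^ (2 * n)) ^ Fintype.card I * S ^ n) ≤ 2 * ((Y ^ (2 * n)) ^ n * S ^ n) := by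
            gcongr
            exact Nat.one_le_pow _ _ hY1
        _ = A * B ^ n := by
            rw [hA, hB]
            obtain ⟨k, hk⟩ : ∃ k, 2 * n = k + 1 := ⟨2 * n - 1, by omega⟩
            rw [hk, Nat.add_sub_cancel]
            rw [pow_succ, mul_pow]; ring)
    (fun _ => ⟨0, hS1⟩)
    (by simp [g, comb]) (by simp [E]) i0 (by simp [cc])
    (by
      intro δ δ' h
      have h1 : (e i0 δ : K) = e i0 δ' := ι.injective h
      have h2 : d δ = d δ' := by
        have h3 : ∀ δ, (e i0 δ : K) = (d δ : K) := fun _ => rfl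
        rw [h3, h3] at h1
        exact_mod_cast h1
      exact comb_inj b B h2)
    Hξ hHξ
  -- analytic part
  obtain ⟨R, hR0, hR⟩ : ∃ R : ℝ, 0 ≤ R ∧ R ^ (2 * n) = m := by
    refine ⟨(m : ℝ) ^ (((2 * n : ℕ) : ℝ)⁻¹), by positivity, ?_⟩
    exact Real.rpow_inv_natCast_pow (by positivity) (by omega)
  obtain ⟨M₁, hM₁⟩ : ∃ M₁ : ℝ, M₁ = w * A + n * B * x₀ := ⟨_, rfl⟩
  have hM₁0 : 0 ≤ M₁ := by rw [hM₁]; positivity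
  have hB0 : (0 : ℝ) ≤ B := by positivity
  have hunκ : u ^ n ≤ κ := by linarith
  have hqn : ‖(ι Q ^ B) ^ Fintype.card J‖ ≤ κ ^ B := by
    rw [hJ, norm_pow, norm_pow, ← pow_mul, mul_comm, pow_mul]
    have : ‖ι Q‖ ≤ u := by rw [hu]; have := hu₂ ι; linarith
    calc _ ≤ (u ^ n) ^ B := by gcongr
      _ ≤ _ := by gcongr
  obtain ⟨D, hD0, h4S, hR1, hD, hfin⟩ := numerics n c S Y m A B κ R M ρ₀ ((u ^ n) ^ B)
    ‖(ι Q ^ B) ^ Fintype.card J‖ cS Cc M₁ (κ * R) (n * B * x₀) Hξ hn hc1 hS (by omega) hX2 hX3 (by omega) (by omega)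
    hTm hA hB hR0 hR hκ1 (by linarith)
    (by
      rw [hM]
      have h1 : (A : ℝ) ≤ κ * A := by nlinarith
      have h2 : n * B * β ≤ κ * B := by
        have : (n * β) * B ≤ κ * B := by gcongr; linarith
        linarith
      linarith)
    (by linarith) (by linarith) (by positivity) (by gcongr) (norm_nonneg _) hqn (by linarith) (by linarith)
    hCc0 (by linarith) hM₁0
    (by
      rw [hM₁, mul_add]
      have h1 : w * A ≤ κ * A := by gcongr; linarith
      have h2 : n * B * x₀ ≤ κ * B := by
        have : (n * x₀) * B ≤ κ * B := by gcongr; linarith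
        linarith
      linarith)
    (by positivity) le_rfl
    (by
      have : ((n + 1) * n * x₀) * (R * B) ≤ κ * (R * B) := by gcongr; linarith
      linarith)
    (Fintype.card Δ) hcardΔ (Fintype.card I) hI hHξ
  have hfin := hfin hc
  let Xop : I → Δ → ℂ[X] := fun i δ => C (ι (cc i)) * X + C (ι (e i δ))
  let Yop : J → Δ → ℂ[X] := fun k δ => C ((N : ℂ) * ι (b k)) * X + C (E₁ k δ)
  obtain ⟨hops1, hops2⟩ := ops ι ω N hω b cd hcd d Xop
    (by
      intro i δ
      simp only [Xop]
      congr 3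
      simp only [cc]
      by_cases h : i = i0
      · have h' : i.1 = 1 := by rw [h]
        rw [if_pos h, if_pos h']
        have : ((1 : 𝓞 K) : K) = 1 := rfl
        rw [this, map_one]
      · have h' : ¬ i.1 = 1 := fun hh => h (Subtype.ext hh)
        rw [if_neg h, if_neg h', oi_zero, map_zero]) Yop (fun _ _ => rfl)
  have hcombs : ∀ s : J → Fin S, ι (g s) = ∑ k, ((s k : ℕ) : ℂ) * ((N : ℂ) * ι (b k)) := by
    intro s
    rw [hg_val, comb_emb, Finset.mul_sum]
    refine Finset.sum_congr rfl fun k _ => by ring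
  have hE₁b : ∀ k δ, ‖E₁ k δ‖ ≤ n * B * x₀ := by
    intro k δ
    simp only [E₁, d]
    rw [hom_comb]
    have := norm_comb_le (fun k => (δ k : ℕ)) B (fun k => (δ k).2.le) (fun j => χ (b j * b k)) x₀
      (fun j => hx₀ j k) hx₀0
    rwa [hJ] at this
  have hwk : ∀ k, ‖(N : ℂ) * ι (b k)‖ ≤ w := by
    intro k
    rw [norm_mul, Complex.norm_intCast, hw]
    have := hβ ι k
    gcongr
  have hup := upper_bound P A hPdeg (fun k => (N : ℂ) * ι (b k)) E₁ Xop Yop (fun k => rfl)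
    (fun i k => (ω i.1)⁻¹ * cd i.1 k) hops1 (fun k i => ι (i.1 (b k : K)) * ω i.1) hops2 S hS1 m
    (by
      intro s hs l hl
      have := hvan (fun k => ⟨s k, hs k⟩) l hl
      rw [hcombs] at this
      exact this)
    Cc M₁ R (κ * R) (A * Hξ * (κ * R) ^ A) w (n * B * x₀) D hCc hCc0
    (by
      intro k δ
      rw [hM₁]
      have := hwk k
      have := hE₁b k δ
      gcongr)
    hM₁0 hwk hw0 hE₁b (by positivity) h4S (by nlinarith)
    (by
      rw [hJ]
      have : ((n + 1) * w) * R ≤ κ * R := by gcongr; linarith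
      linarith)
    (fun δ => hPwn δ _ (by nlinarith))
    (by rw [hJ]; exact hD) hD0 (fun k => (s k : ℕ)) (fun k => (s k).2) l hl
  rw [← hcombs s] at hup
  refine absurd (hlow.trans ?_) (not_le.2 hfin)
  refine mul_le_mul_of_nonneg_right ?_ ?_
  · exact mul_le_mul_of_nonneg_left hup (norm_nonneg _)
  · have hM0 : 0 ≤ M := by linarith
    have : 0 ≤ Hξ := by rw [hHξ]; positivity
    positivity
end PartI

section PartJ
open Polynomial NumberField

theorem baker {J : Type} [Fintype J] (β lam : J → ℂ) (hβ : ∀ j, IsAlgebraic ℚ (β j))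
    (hlam : ∀ j, IsAlgebraic ℚ (Complex.exp (lam j))) (h0 : ∑ j, β j * lam j ≠ 0) :
    Transcendental ℚ (∑ j, β j * lam j) := by
  classical
  intro hF
  set F := ∑ j, β j * lam j with hFdef
  let β' : J → ℂ := fun j => β j * F⁻¹
  have hβ' : ∀ j, IsAlgebraic ℚ (β' j) := fun j => (hβ j).mul hF.inv
  have hsum : ∑ j, β' j * lam j = 1 := by
    have : ∑ j, β' j * lam j = F * F⁻¹ := by
      rw [hFdef, Finset.sum_mul]
      refine Finset.sum_congr rfl fun j _ => by simp only [β']; ring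
    rw [this, mul_inv_cancel₀ h0]
  let p : ℚ[X] := ∏ j, (minpoly ℚ (β' j) * minpoly ℚ (Complex.exp (lam j)))
  have hp : p ≠ 0 := by
    refine Finset.prod_ne_zero_iff.2 fun j _ => mul_ne_zero ?_ ?_
    · exact minpoly.ne_zero (hβ' j).isIntegral
    · exact minpoly.ne_zero (hlam j).isIntegral
  have hsp : (p.map (algebraMap ℚ ℂ)).Splits := IsAlgClosed.splits _
  let K : IntermediateField ℚ ℂ := IntermediateField.adjoin ℚ (p.rootSet ℂ)
  haveI : p.IsSplittingField ℚ K := IntermediateField.adjoin_rootSet_isSplittingField hsp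
  haveI : FiniteDimensional ℚ K := Polynomial.IsSplittingField.finiteDimensional K p
  haveI : NumberField K := ⟨⟩
  haveI : Normal ℚ K := Normal.of_isSplittingField p
  haveI : IsGalois ℚ K := ⟨⟩
  have hmem : ∀ z : ℂ, aeval z p = 0 → z ∈ K := fun z hz =>
    IntermediateField.subset_adjoin ℚ _ ((mem_rootSet_of_ne hp).2 hz)
  have h1 : ∀ j, β' j ∈ K := by
    intro j
    apply hmem
    simp only [p, map_prod]
    exact Finset.prod_eq_zero (Finset.mem_univ j) (by simp [minpoly.aeval])
  have h2 : ∀ j, Complex.exp (lam j) ∈ K := by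
    intro j
    apply hmem
    simp only [p, map_prod]
    exact Finset.prod_eq_zero (Finset.mem_univ j) (by simp [minpoly.aeval])
  let ι : K →+* ℂ := algebraMap K ℂ
  let bK : J → K := fun j => ⟨β' j, h1 j⟩
  let aK : J → K := fun j => ⟨Complex.exp (lam j), h2 j⟩
  obtain ⟨N, hN, hint⟩ := exists_integral_multiples ℤ ℚ (Finset.univ.image bK)
  have hint' : ∀ j, IsIntegral ℤ (N • bK j) := fun j => hint _ (by simp)
  let bI : J → 𝓞 K := fun j => ⟨N • bK j, hint' j⟩
  have hbI : ∀ j, ((bI j : 𝓞 K) : K) = N • bK j := fun j => rfl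
  let ω : Gal(K/ℚ) → ℂ := fun σ => ∑ j, ι (σ (bI j : K)) * lam j
  refine core K ι ω N hN ?_ ?_
  · simp only [ω]
    have : ∀ j, ι ((1 : Gal(K/ℚ)) (bI j : K)) = N * β' j := by
      intro j
      rw [hbI]
      simp [ι, bK, IntermediateField.algebraMap_apply]
    simp only [this, mul_assoc, ← Finset.mul_sum, hsum, mul_one]
  · intro x
    let t : J → ℤ := fun j => Algebra.trace ℤ (𝓞 K) (x * bI j)
    refine ⟨∏ j, aK j ^ t j, ?_⟩
    have ht : ∀ j, ∑ σ : Gal(K/ℚ), ι (σ (x : K)) * ι (σ (bI j : K)) = t j := by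
      intro j
      have h3 := trace_eq_sum_automorphisms (K := ℚ) (L := K) ((x * bI j : 𝓞 K) : K)
      have h4 : Algebra.trace ℚ K ((x * bI j : 𝓞 K) : K) = (t j : ℚ) := (Algebra.coe_trace_int _).symm
      rw [h4] at h3
      have h5 := congrArg ι h3
      rw [map_sum] at h5
      simp only [oi_mul, map_mul] at h5
      rw [← h5]
      simp [ι]
    have h3 : chiHom ι ω x = ∑ j, (t j : ℂ) * lam j := by
      rw [chiHom_apply]
      simp only [ω, Finset.mul_sum]
      rw [Finset.sum_comm]
      refine Finset.sum_congr rfl fun j _ => ?_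
      rw [← ht j, Finset.sum_mul]
      refine Finset.sum_congr rfl fun σ _ => by ring
    rw [h3, Complex.exp_sum, map_prod]
    refine Finset.prod_congr rfl fun j _ => ?_
    rw [map_zpow₀, Complex.exp_int_mul]
    rfl
end PartJ

section PartK
open Filter Topology Finset

def dD (w : ℕ → ℝ) : ℕ → ℝ := fun j => w j - w (j + 1)
def CMon (w : ℕ → ℝ) : Prop := ∀ r j, 0 < (dD^[r] w) j

lemma tm_even (n : ℕ) : tmSign (2 * n) = tmSign n := by
  unfold tmSign
  rcases Nat.eq_zero_or_pos n with rfl | h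
  · simp
  · rw [Nat.digits_def' (by norm_num) (by omega)]
    simp
lemma tm_odd (n : ℕ) : tmSign (2 * n + 1) = - tmSign n := by
  unfold tmSign
  rw [Nat.digits_def' (by norm_num) (by omega)]
  have h1 : (2 * n + 1) % 2 = 1 := by omega
  have h2 : (2 * n + 1) / 2 = n := by omega
  rw [h1, h2, List.sum_cons, pow_add]; simp

lemma fPer_even (k n : ℕ) : fPer (k+1) (2 * n) = fPer k n := by
  unfold fPer
  rw [pow_succ', Nat.mul_mod_mul_left, tm_even]
lemma fPer_odd (k n : ℕ) : fPer (k+1) (2 * n + 1) = - fPer k n := by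
  unfold fPer
  have : (2 * n + 1) % (2 ^ (k+1)) = 2 * (n % 2 ^ k) + 1 := by
    rw [pow_succ', Nat.mod_mul]
    have h1 : (2 * n + 1) % 2 = 1 := by omega
    have h2 : (2 * n + 1) / 2 = n := by omega
    rw [h1, h2]; ring
  rw [this, tm_odd]
lemma fPer_zero (n : ℕ) : fPer 0 n = 1 := by
  simp [fPer, tmSign, Nat.mod_one]
lemma fPer_cases (k n : ℕ) : fPer k n = 1 ∨ fPer k n = -1 := by
  unfold fPer tmSign
  exact neg_one_pow_eq_or ℝ _
lemma fPer_abs (k n : ℕ) : |fPer k n| = 1 := by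
  rcases fPer_cases k n with h | h <;> rw [h] <;> simp
lemma fPer_period (k n : ℕ) : fPer k (n + 2 ^ k) = fPer k n := by
  simp [fPer]

lemma dD_shift (r : ℕ) (w : ℕ → ℝ) (j : ℕ) : (dD^[r] (fun i => w (i+1))) j = (dD^[r] w) (j+1) := by
  induction r generalizing j with
  | zero => rfl
  | succ r ih => rw [Function.iterate_succ_apply', Function.iterate_succ_apply']; simp only [dD]; rw [ih, ih]
lemma dD_add (r : ℕ) (u w : ℕ → ℝ) (j : ℕ) : (dD^[r] (fun i => u i + w i)) j = (dD^[r] u) j + (dD^[r] w) j := by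
  induction r generalizing j with
  | zero => rfl
  | succ r ih => rw [Function.iterate_succ_apply', Function.iterate_succ_apply', Function.iterate_succ_apply']; simp only [dD]; rw [ih, ih]; ring

lemma CMon.D {w : ℕ → ℝ} (h : CMon w) : CMon (dD w) := fun r j => by
  rw [← Function.iterate_succ_apply]; exact h _ _
lemma CMon.E {w : ℕ → ℝ} (h : CMon w) : CMon (fun i => w (i+1)) := fun r j => by
  rw [dD_shift]; exact h _ _
lemma CMon.add {u w : ℕ → ℝ} (hu : CMon u) (h : CMon w) : CMon (fun i => u i + w i) := fun r j => by
  rw [dD_add]; exact add_pos (hu _ _) (h _ _)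
lemma CMon.pos {w : ℕ → ℝ} (h : CMon w) (j : ℕ) : 0 < w j := h 0 j
lemma CMon.lt {w : ℕ → ℝ} (h : CMon w) (j : ℕ) : w (j+1) < w j := by
  have := h 1 j
  simp only [Function.iterate_one, dD] at this
  linarith
lemma CMon.S {u : ℕ → ℝ} (h : CMon u) (a : ℕ) : CMon (fun i => u (2*i+a)) := by
  intro r
  induction r generalizing u with
  | zero => intro j; exact h.pos _
  | succ r ih =>
    intro j
    rw [Function.iterate_succ_apply]
    have := ih (h.D.add h.D.E) j
    convert this using 2
    funext i
    simp only [dD]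
    rw [show 2 * (i+1) + a = 2 * i + a + 1 + 1 by ring]; ring

lemma CMon_inv (a : ℕ) : CMon (fun j => 1 / ((j:ℝ) + a + 1)) := by
  have key : ∀ r j : ℕ, (dD^[r] (fun j => 1 / ((j:ℝ) + a + 1))) j
      = (r.factorial : ℝ) / ∏ i ∈ range (r+1), ((j:ℝ) + a + 1 + i) := by
    intro r
    induction r with
    | zero => intro j; simp
    | succ r ih =>
      intro j
      rw [Function.iterate_succ_apply']; simp only [dD]; rw [ih, ih]
      have e1 : ∏ i ∈ range (r+1), (((j+1:ℕ):ℝ) + a + 1 + i) = ∏ i ∈ range (r+1), ((j:ℝ) + a + 1 + ((i+1:ℕ):ℝ)) := by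
        apply prod_congr rfl; intros; push_cast; ring
      rw [e1, prod_range_succ _ (r+1), prod_range_succ' _ r, prod_range_succ _ r]
      have hP : 0 < ∏ i ∈ range r, ((j:ℝ) + a + 1 + ((i+1:ℕ):ℝ)) := by
        apply prod_pos; intros; positivity
      set P := ∏ i ∈ range r, ((j:ℝ) + a + 1 + ((i+1:ℕ):ℝ))
      have h1 : (0:ℝ) < (j:ℝ) + a + 1 := by positivity
      have h2 : (0:ℝ) < (j:ℝ) + a + 1 + ((r+1:ℕ):ℝ) := by positivity
      rw [Nat.factorial_succ]
      push_cast at *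
      field_simp
      simp only [add_zero]
      ring
  intro r j
  rw [key]
  apply div_pos (by positivity)
  apply prod_pos; intros; positivity

lemma sum_prs (g : ℕ → ℝ) (n : ℕ) : ∑ j ∈ range (2*n), g j = ∑ i ∈ range n, (g (2*i) + g (2*i+1)) := by
  induction n with
  | zero => simp
  | succ n ih => rw [show 2*(n+1) = 2*n+1+1 by ring, sum_range_succ, sum_range_succ, ih, sum_range_succ]; ring

theorem sign_lemma (k : ℕ) : ∀ (m : ℕ) (w : ℕ → ℝ) (L : ℝ), CMon w →
    Tendsto (fun n => ∑ j ∈ range n, fPer k (m+j) * w j) atTop (𝓝 L) → 0 < fPer k m * L := by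
  induction k with
  | zero =>
    intro m w L hw hL
    simp only [fPer_zero, one_mul] at *
    have : w 0 ≤ L := by
      apply ge_of_tendsto hL
      filter_upwards [eventually_ge_atTop 1] with n hn
      have : w 0 = ∑ j ∈ range 1, w j := by simp
      rw [this]
      apply sum_le_sum_of_subset_of_nonneg
      · intro x; simp; omega
      · intros; exact (hw.pos _).le
    linarith [hw.pos 0]
  | succ k ih =>
    intro m w L hw hL
    obtain ⟨p, rfl | rfl⟩ : ∃ p, m = 2 * p ∨ m = 2 * p + 1 := ⟨m/2, by omega⟩
    · rw [fPer_even]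
      apply ih p _ L (hw.D.S 0)
      have h2 : Tendsto (fun n : ℕ => 2 * n) atTop atTop := tendsto_atTop_mono (fun n => by simp only [id]; omega) tendsto_id
      refine (hL.comp h2).congr ?_
      intro n
      simp only [Function.comp]
      rw [sum_prs]
      apply sum_congr rfl
      intro i _
      rw [show 2 * p + 2 * i = 2 * (p + i) by ring, show 2 * p + (2 * i + 1) = 2 * (p + i) + 1 by ring, fPer_even, fPer_odd]
      simp only [dD, add_zero]; ring
    · have h2 : Tendsto (fun n : ℕ => 2 * n + 1) atTop atTop :=
        tendsto_atTop_mono (fun n => by simp only [id]; omega) tendsto_id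
      have h3 := hL.comp h2
      have hb : |L - fPer (k+1) (2*p+1) * w 0| ≤ w 1 := by
        have h4 := (h3.sub_const (fPer (k+1) (2*p+1) * w 0)).abs
        apply le_of_tendsto' h4
        intro n
        simp only [Function.comp]
        rw [sum_range_succ', sum_prs]
        simp only [add_zero, add_sub_cancel_right]
        have : ∀ n : ℕ, |∑ i ∈ range n, (fPer (k+1) (2*p+1+(2*i+1)) * w (2*i+1) + fPer (k+1) (2*p+1+(2*i+1+1)) * w (2*i+1+1))| ≤ w 1 - w (2*n+1) := by
          intro n
          induction n with
          | zero => simp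
          | succ n ih =>
            rw [sum_range_succ]
            refine (abs_add_le _ _).trans ?_
            have : |(fPer (k+1) (2*p+1+(2*n+1)) * w (2*n+1) + fPer (k+1) (2*p+1+(2*n+1+1)) * w (2*n+1+1))| ≤ w (2*n+1) - w (2*n+1+1) := by
              rw [show 2*p+1+(2*n+1) = 2 * (p+n+1) by ring, show 2*p+1+(2*n+1+1) = 2*(p+n+1)+1 by ring, fPer_even, fPer_odd]
              rw [show fPer k (p + n + 1) * w (2 * n + 1) + -fPer k (p + n + 1) * w (2 * n + 1 + 1) = fPer k (p+n+1) * (w (2*n+1) - w (2*n+1+1)) by ring, abs_mul, fPer_abs, one_mul, abs_of_pos]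
              linarith [hw.lt (2*n+1)]
            have := hw.lt (2*n+1+1)
            rw [show 2*(n+1)+1 = 2*n+1+1+1 by ring]
            linarith
        exact (this n).trans (by linarith [hw.pos (2*n+1)])
      have := hw.lt 0
      rw [abs_le] at hb
      rcases fPer_cases (k+1) (2*p+1) with h | h <;> rw [h] at hb ⊢ <;> simp at this <;> linarith

lemma sum_fPer_two (k n : ℕ) : ∑ i ∈ range (2*n), fPer (k+1) i = 0 := by
  rw [sum_prs]; apply sum_eq_zero; intro i _; rw [fPer_even, fPer_odd]; ring
lemma sum_fPer_bd (k n : ℕ) : |∑ i ∈ range n, fPer (k+1) i| ≤ 1 := by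
  obtain ⟨p, rfl | rfl⟩ : ∃ p, n = 2 * p ∨ n = 2 * p + 1 := ⟨n/2, by omega⟩
  · rw [sum_fPer_two]; simp
  · rw [sum_range_succ, sum_fPer_two, zero_add, fPer_abs]
lemma sum_fPer_shift (k m n : ℕ) : ∑ i ∈ range n, fPer (k+1) (m+i) =
    ∑ i ∈ range (m+n), fPer (k+1) i - ∑ i ∈ range m, fPer (k+1) i := by
  rw [sum_range_add]; ring
lemma sum_fPer_period (k m : ℕ) : ∑ i ∈ range (2^(k+1)), fPer (k+1) (m+i) = 0 := by
  rw [sum_fPer_shift]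
  obtain ⟨p, rfl | rfl⟩ : ∃ p, m = 2 * p ∨ m = 2 * p + 1 := ⟨m/2, by omega⟩
  · rw [pow_succ', ← mul_add, sum_fPer_two, sum_fPer_two]; simp
  · rw [show 2*p+1+2^(k+1) = 2*(p+2^k)+1 by ring, sum_range_succ, sum_range_succ, sum_fPer_two, sum_fPer_two]
    rw [show 2*(p+2^k) = 2*p+2^(k+1) by ring, fPer_period]; ring

theorem conv_lemma (k m a : ℕ) : ∃ L, Tendsto (fun n => ∑ j ∈ range n, fPer (k+1) (m+j) * (1 / ((j:ℝ) + a + 1))) atTop (𝓝 L) := by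
  have hanti : Antitone (fun j : ℕ => 1 / ((j:ℝ) + a + 1)) := antitone_nat_of_succ_le fun n => ((CMon_inv a).lt n).le
  have h0 : Tendsto (fun j : ℕ => 1 / ((j:ℝ) + a + 1)) atTop (𝓝 0) := by
    have := (tendsto_one_div_add_atTop_nhds_zero_nat (𝕜 := ℝ)).comp (tendsto_add_atTop_nat a)
    refine this.congr ?_
    intro x; simp
  have hb : ∀ n, ‖∑ i ∈ range n, fPer (k+1) (m+i)‖ ≤ 2 := by
    intro n
    rw [sum_fPer_shift, Real.norm_eq_abs]
    have h1 := sum_fPer_bd k (m+n)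
    have h2 := sum_fPer_bd k m
    rw [abs_le] at *
    constructor <;> linarith
  have := hanti.cauchySeq_series_mul_of_tendsto_zero_of_bounded h0 hb
  obtain ⟨L, hL⟩ := cauchySeq_tendsto_of_complete this
  refine ⟨L, hL.congr ?_⟩
  intro n
  apply sum_congr rfl; intros; simp [mul_comm]
end PartK

section PartL
open Filter Topology Finset

noncomputable def pS (k m n : ℕ) : ℝ := ∑ j ∈ range n, fPer (k+1) (m+1+j) * (1 / ((j:ℝ) + (0:ℕ) + 1))
noncomputable def Lf (k m : ℕ) : ℝ := Classical.choose (conv_lemma k (m+1) 0)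
lemma Lf_tendsto (k m : ℕ) : Tendsto (pS k m) atTop (𝓝 (Lf k m)) := Classical.choose_spec (conv_lemma k (m+1) 0)

lemma pS_succ (k m n : ℕ) : pS k m (n+1) = pS k m n + fPer (k+1) (n+1+m) / (n+1) := by
  unfold pS
  rw [sum_range_succ, show m+1+n = n+1+m by ring]
  simp [div_eq_mul_inv]
lemma gSigma_succ (τ : ℝ) (n : ℕ) : gSigma τ (n+1) = gSigma τ n + gSign τ (n+1) / (n+1) := by
  simp [gSigma, gSign]

lemma Lf_sign (k m n : ℕ) : 0 < fPer (k+1) (n+1+m) * (Lf k m - pS k m n) := by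
  rw [show n+1+m = m+1+n by ring]
  apply sign_lemma (k+1) (m+1+n) _ _ (CMon_inv n)
  have h1 : Tendsto (fun i => pS k m (n+i) - pS k m n) atTop (𝓝 (Lf k m - pS k m n)) := by
    apply Tendsto.sub_const
    exact (Lf_tendsto k m).comp (tendsto_atTop_mono (fun i => by simp only [id]; omega) tendsto_id)
  refine h1.congr ?_
  intro i
  unfold pS
  rw [sum_range_add, add_sub_cancel_left]
  apply sum_congr rfl
  intro j _
  push_cast
  rw [show m+1+(n+j) = m+1+n+j by ring, show ((n:ℝ)+j+0+1) = (j:ℝ)+n+1 by ring]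

lemma Lf_ne_zero (k m : ℕ) : Lf k m ≠ 0 := by
  intro h
  have := Lf_sign k m 0
  rw [h] at this
  simp [pS] at this

theorem X_nonempty (k : ℕ) : (Xset (k+1)).Nonempty := by
  have hs : ∀ n, gSigma (Lf k 0) n = pS k 0 n → gSign (Lf k 0) (n+1) = fPer (k+1) (n+1) := by
    intro n hn
    have := Lf_sign k 0 n
    simp only [gSign, Nat.add_sub_cancel]
    rw [hn]
    simp only [add_zero] at this
    rcases fPer_cases (k+1) (n+1) with h | h <;> rw [h] at this ⊢
    · rw [if_pos]; linarith
    · rw [if_neg]; linarith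
  have hE : ∀ n, gSigma (Lf k 0) n = pS k 0 n := by
    intro n
    induction n with
    | zero => simp [gSigma, pS]
    | succ n ih => rw [gSigma_succ, pS_succ, ih, hs n ih]
  refine ⟨Lf k 0, 0, 0, by positivity, ?_⟩
  intro n hn _
  obtain ⟨n, rfl⟩ : ∃ j, n = j + 1 := ⟨n-1, by omega⟩
  exact hs n (hE n)

lemma gSign_rat (τ : ℝ) (n : ℕ) : ∃ q : ℚ, gSign τ n = q := by
  unfold gSign; split_ifs
  · exact ⟨1, by simp⟩
  · exact ⟨-1, by simp⟩
lemma gSigma_rat (τ : ℝ) (n : ℕ) : ∃ q : ℚ, gSigma τ n = q := by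
  induction n with
  | zero => exact ⟨0, by simp [gSigma]⟩
  | succ n ih =>
    obtain ⟨q, hq⟩ := ih
    obtain ⟨p, hp⟩ := gSign_rat τ (n+1)
    exact ⟨q + p / (n+1), by rw [gSigma_succ, hq, hp]; push_cast; rfl⟩
lemma fPer_rat (k n : ℕ) : ∃ q : ℚ, fPer k n = q := by
  rcases fPer_cases k n with h | h
  · exact ⟨1, by simp [h]⟩
  · exact ⟨-1, by simp [h]⟩
lemma pS_rat (k m n : ℕ) : ∃ q : ℚ, pS k m n = q := by
  induction n with
  | zero => exact ⟨0, by simp [pS]⟩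
  | succ n ih =>
    obtain ⟨q, hq⟩ := ih
    obtain ⟨p, hp⟩ := fPer_rat (k+1) (n+1+m)
    exact ⟨q + p / (n+1), by rw [pS_succ, hq, hp]; push_cast; rfl⟩

theorem X_repr (k : ℕ) (τ : ℝ) (h : τ ∈ Xset (k+1)) : ∃ (m : ℕ) (q : ℚ), τ = q + Lf k m := by
  obtain ⟨N, m, -, h⟩ := h
  obtain ⟨q1, h1⟩ := gSigma_rat τ N
  obtain ⟨q2, h2⟩ := pS_rat k m N
  refine ⟨m, q1 - q2, ?_⟩
  have hE : ∀ n, N ≤ n → gSigma τ n = ((q1 - q2 : ℚ) : ℝ) + pS k m n := by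
    intro n hn
    induction n, hn using Nat.le_induction with
    | base => rw [h1, h2]; push_cast; ring
    | succ n hn ih => rw [gSigma_succ, pS_succ, ih, h (n+1) (by omega) (by omega)]; ring
  have hT : Tendsto (gSigma τ) atTop (𝓝 (((q1 - q2 : ℚ) : ℝ) + Lf k m)) := by
    refine ((Lf_tendsto k m).const_add _).congr' ?_
    filter_upwards [eventually_ge_atTop N] with n hn
    rw [hE n hn]
  have hsgn : ∀ a, ∃ n ≥ a, gSign τ (n+1) = 1 := by
    intro a
    have e1 := fPer_even k (a+N+m+1)
    have e2 := fPer_odd k (a+N+m+1)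
    have r1 := h (2*(a+N+m+1) - m) (by omega) (by omega)
    have r2 := h (2*(a+N+m+1)+1 - m) (by omega) (by omega)
    rw [Nat.sub_add_cancel (by omega)] at r1 r2
    rcases fPer_cases k (a+N+m+1) with h | h
    · exact ⟨2*(a+N+m+1) - m - 1, by omega, by rw [Nat.sub_add_cancel (by omega), r1, e1, h]⟩
    · exact ⟨2*(a+N+m+1)+1 - m - 1, by omega, by rw [Nat.sub_add_cancel (by omega), r2, e2, h]; norm_num⟩
  have hsgn2 : ∀ a, ∃ n ≥ a, gSign τ (n+1) = -1 := by
    intro a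
    have e1 := fPer_even k (a+N+m+1)
    have e2 := fPer_odd k (a+N+m+1)
    have r1 := h (2*(a+N+m+1) - m) (by omega) (by omega)
    have r2 := h (2*(a+N+m+1)+1 - m) (by omega) (by omega)
    rw [Nat.sub_add_cancel (by omega)] at r1 r2
    rcases fPer_cases k (a+N+m+1) with h | h
    · exact ⟨2*(a+N+m+1)+1 - m - 1, by omega, by rw [Nat.sub_add_cancel (by omega), r2, e2, h]⟩
    · exact ⟨2*(a+N+m+1) - m - 1, by omega, by rw [Nat.sub_add_cancel (by omega), r1, e1, h]⟩
  apply le_antisymm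
  · apply ge_of_tendsto_of_frequently hT
    rw [frequently_atTop]
    intro a
    obtain ⟨n, hn, h⟩ := hsgn2 a
    refine ⟨n, hn, ?_⟩
    simp only [gSign, Nat.add_sub_cancel] at h
    split_ifs at h with h'
    · norm_num at h
    · exact (not_le.mp h').le
  · apply le_of_tendsto_of_frequently hT
    rw [frequently_atTop]
    intro a
    obtain ⟨n, hn, h⟩ := hsgn a
    refine ⟨n, hn, ?_⟩
    simp only [gSign, Nat.add_sub_cancel] at h
    split_ifs at h with h'
    · exact h'
    · norm_num at h

theorem X_countable (k : ℕ) : (Xset (k+1)).Countable := by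
  apply (Set.countable_range (fun p : ℕ × ℚ => (p.2 : ℝ) + Lf k p.1)).mono
  intro τ h
  obtain ⟨m, q, h⟩ := X_repr k τ h
  exact ⟨(m, q), h.symm⟩

lemma tm_pow (k : ℕ) : tmSign (2^k) = -1 := by
  induction k with
  | zero => simp [tmSign]
  | succ k ih => rw [pow_succ', tm_even, ih]

theorem X_disj_lt (k l : ℕ) (h : k < l) : Xset k ∩ Xset l = ∅ := by
  rw [Set.eq_empty_iff_forall_notMem]
  rintro τ ⟨⟨N, m, -, h1⟩, ⟨N', m', -, h2⟩⟩
  have hB : N + N' + m' + 1 ≤ 2^l * (N + N' + m' + 1) := Nat.le_mul_of_pos_left _ (by positivity)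
  set B := N + N' + m' + 1 with hBd
  have a1 := h1 (2^l*B - m') (by omega) (by omega)
  have a2 := h2 (2^l*B - m') (by omega) (by omega)
  have a3 := h1 (2^l*B - m' + 2^k) (Nat.le_add_right_of_le (by omega)) (Nat.le_add_right_of_le (by omega))
  have a4 := h2 (2^l*B - m' + 2^k) (Nat.le_add_right_of_le (by omega)) (Nat.le_add_right_of_le (by omega))
  rw [Nat.sub_add_cancel (by omega)] at a2
  rw [show 2^l*B - m' + 2^k + m' = 2^k + 2^l*B by omega] at a4
  rw [show 2^l*B - m' + 2^k + m = 2^l*B - m' + m + 2^k by omega, fPer_period, ← a1, a2] at a3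
  rw [a3] at a4
  simp only [fPer, Nat.add_mul_mod_self_left, Nat.mul_mod_right] at a4
  rw [Nat.mod_eq_of_lt (Nat.pow_lt_pow_right (by norm_num) h), tm_pow] at a4
  simp [tmSign] at a4
  norm_num at a4
end PartL

section PartM
open Filter Topology Finset

lemma root_sum (q : ℕ) (hq : 0 < q) (ζ : ℂ) (hζ : IsPrimitiveRoot ζ q) (n a : ℕ) (ha : a < q) :
    ∑ j ∈ range q, ζ ^ (j * n) * (ζ⁻¹) ^ (j * a) = if a = n % q then (q : ℂ) else 0 := by
  have h0 : ζ ≠ 0 := hζ.ne_zero hq.ne'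
  have e : ∀ j, ζ ^ (j * n) * (ζ⁻¹) ^ (j * a) = (ζ ^ n * ζ⁻¹ ^ a) ^ j := by
    intro j; rw [mul_pow, ← pow_mul, ← pow_mul, mul_comm n, mul_comm a]
  simp only [e]
  have hmod : ζ ^ n = ζ ^ (n % q) := by
    conv_lhs => rw [← Nat.div_add_mod n q, pow_add, pow_mul, hζ.pow_eq_one, one_pow, one_mul]
  split_ifs with h
  · rw [hmod, ← h, inv_pow, mul_inv_cancel₀ (pow_ne_zero _ h0)]
    simp
  · have hne : ζ ^ n * ζ⁻¹ ^ a ≠ 1 := by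
      intro h1
      apply h
      apply hζ.pow_inj ha (Nat.mod_lt _ hq)
      rw [← hmod]
      rw [inv_pow] at h1
      exact (eq_of_div_eq_one (by rw [div_eq_mul_inv]; exact h1)).symm
    rw [geom_sum_eq hne]
    have : (ζ ^ n * ζ⁻¹ ^ a) ^ q = 1 := by
      rw [mul_pow, ← pow_mul, ← pow_mul, mul_comm n, mul_comm a, pow_mul, pow_mul, inv_pow, hζ.pow_eq_one]; simp
    rw [this]; simp

lemma fPer_fourier (k m : ℕ) (ζ : ℂ) (hζ : IsPrimitiveRoot ζ (2^k)) (n : ℕ) :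
    (fPer k (m + n) : ℂ) = ∑ j ∈ range (2^k),
      ((1/(2^k : ℂ)) * ∑ a ∈ range (2^k), (fPer k (m+a) : ℂ) * (ζ⁻¹) ^ (j * a)) * ζ ^ (j * n) := by
  have hq : 0 < 2^k := by positivity
  have : ∀ j ∈ range (2^k), ((1/(2^k : ℂ)) * ∑ a ∈ range (2^k), (fPer k (m+a) : ℂ) * (ζ⁻¹) ^ (j * a)) * ζ ^ (j * n)
      = ∑ a ∈ range (2^k), (1/(2^k : ℂ)) * ((fPer k (m+a) : ℂ) * (ζ ^ (j * n) * (ζ⁻¹) ^ (j * a))) := by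
    intro j _
    rw [mul_sum, sum_mul]; apply sum_congr rfl; intros; ring
  rw [sum_congr rfl this, sum_comm]
  simp only [← mul_sum]
  have h2 : ∑ a ∈ range (2^k), (fPer k (m+a) : ℂ) * ∑ j ∈ range (2^k), (ζ ^ (j * n) * (ζ⁻¹) ^ (j * a))
    = ∑ a ∈ range (2^k), if a = n % 2^k then (fPer k (m+n) : ℂ) * 2^k else 0 := by
    apply sum_congr rfl
    intro a ha
    rw [root_sum _ hq ζ hζ n a (mem_range.mp ha)]
    split_ifs with h
    · rw [h]; simp [fPer]
    · simp
  rw [h2, sum_ite_eq', if_pos (mem_range.mpr (Nat.mod_lt _ hq))]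
  field_simp

lemma alg_sum {ι : Type*} (s : Finset ι) (g : ι → ℂ) (h : ∀ i ∈ s, IsAlgebraic ℚ (g i)) : IsAlgebraic ℚ (∑ i ∈ s, g i) := by
  have : ∑ i ∈ s, g i ∈ algebraicClosure ℚ ℂ := sum_mem fun i hi => (mem_algebraicClosure_iff).2 (h i hi)
  exact mem_algebraicClosure_iff.1 this

theorem Lf_formula (k m : ℕ) (ζ : ℂ) (hζ : IsPrimitiveRoot ζ (2^(k+1))) (c : ℕ → ℂ) (hc0 : c 0 = 0)
    (hc : ∀ n, (fPer (k+1) (m + n) : ℂ) = ∑ j ∈ range (2^(k+1)), c j * ζ ^ (j * n)) :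
    (Lf k m : ℂ) = ∑ j ∈ range (2^(k+1)), c j * (- Complex.log (1 - ζ ^ j)) := by
  have hnorm : ‖ζ‖ = 1 := hζ.norm'_eq_one (by positivity)
  set a : ℕ → ℂ := fun n => (fPer (k+1) (m+n) : ℂ) / n with ha
  have hT : Tendsto (fun n => ∑ i ∈ range n, a i) atTop (𝓝 (Lf k m : ℂ)) := by
    rw [← tendsto_add_atTop_iff_nat 1]
    refine ((Complex.continuous_ofReal.tendsto _).comp (Lf_tendsto k m)).congr ?_
    intro n
    rw [sum_range_succ']
    simp only [Function.comp, pS, ha]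
    push_cast
    simp only [CharP.cast_eq_zero, div_zero, add_zero]
    apply sum_congr rfl
    intro j _
    rw [show m + 1 + j = m + (j+1) by ring]; ring
  have hA := Complex.tendsto_tsum_powerSeries_nhdsWithin_lt hT
  rw [tendsto_map'_iff] at hA
  have hB : Tendsto (fun x : ℝ => ∑ j ∈ range (2^(k+1)), c j * (- Complex.log (1 - ζ ^ j * x))) (𝓝[<] 1)
      (𝓝 (∑ j ∈ range (2^(k+1)), c j * (- Complex.log (1 - ζ ^ j)))) := by
    apply tendsto_finset_sum
    intro j hj
    rcases Nat.eq_zero_or_pos j with rfl | hj0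
    · simp [hc0]
    · apply Tendsto.const_mul
      apply Tendsto.neg
      apply Tendsto.clog
      · have : Continuous (fun x : ℝ => (1 - ζ ^ j * (x:ℂ))) := by fun_prop
        have h1 := (this.tendsto 1).mono_left (nhdsWithin_le_nhds (s := Set.Iio 1))
        simpa using h1
      · left
        have hn : ‖ζ ^ j‖ = 1 := by rw [norm_pow, hnorm, one_pow]
        have hne : ζ ^ j ≠ 1 := hζ.pow_ne_one_of_pos_of_lt hj0.ne' (mem_range.mp hj)
        rw [Complex.sub_re, Complex.one_re, sub_pos]
        rcases lt_or_eq_of_le ((Complex.re_le_norm (ζ^j)).trans hn.le) with h | h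
        · exact h
        · exfalso
          apply hne
          have h3 := Complex.sq_norm (ζ^j)
          rw [hn, Complex.normSq_apply, h] at h3
          apply Complex.ext
          · simp [h]
          · have : (ζ^j).im * (ζ^j).im = 0 := by linarith
            simpa using this
  refine tendsto_nhds_unique hA (hB.congr' ?_)
  have hI : Set.Ioo (0:ℝ) 1 ∈ 𝓝[<] (1:ℝ) := Ioo_mem_nhdsLT (by norm_num)
  filter_upwards [hI] with x hx
  simp only [Function.comp]
  symm
  apply HasSum.tsum_eq
  have hs : HasSum (fun n : ℕ => ∑ j ∈ range (2^(k+1)), c j * ((ζ ^ j * x) ^ n / n)) (∑ j ∈ range (2^(k+1)), c j * (- Complex.log (1 - ζ ^ j * x))) := by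
    apply hasSum_sum
    intro j _
    apply HasSum.mul_left
    apply Complex.hasSum_taylorSeries_neg_log
    rw [norm_mul, norm_pow, hnorm, one_pow, one_mul, Complex.norm_real, Real.norm_eq_abs, abs_of_pos hx.1]
    exact hx.2
  convert hs using 2 with n
  simp only [ha]
  rw [hc, div_mul_eq_mul_div, sum_mul, sum_div]
  apply sum_congr rfl
  intro j _
  rw [mul_pow, ← pow_mul]; ring

theorem Lf_transc (k m : ℕ) : Transcendental ℚ (Lf k m) := by
  set q := 2^(k+1) with hq
  have hq0 : q ≠ 0 := by positivity
  obtain ⟨ζ, hζ⟩ : ∃ ζ : ℂ, IsPrimitiveRoot ζ q := ⟨_, Complex.isPrimitiveRoot_exp q hq0⟩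
  have hζa : IsAlgebraic ℚ ζ := by
    refine ⟨Polynomial.X ^ q - 1, Polynomial.X_pow_sub_C_ne_zero (by positivity) 1, ?_⟩
    simp [hζ.pow_eq_one]
  set c : ℕ → ℂ := fun j => (1/(2^(k+1) : ℂ)) * ∑ a ∈ range (2^(k+1)), (fPer (k+1) (m+a) : ℂ) * (ζ⁻¹) ^ (j * a) with hcd
  have hc0 : c 0 = 0 := by
    simp only [hcd, zero_mul, pow_zero, mul_one]
    rw [← Complex.ofReal_sum, sum_fPer_period]; simp
  have hF := Lf_formula k m ζ hζ c hc0 (fun n => fPer_fourier (k+1) m ζ hζ n)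
  rw [Finset.sum_range] at hF
  have h1 : Transcendental ℚ (∑ j : Fin q, (- c j) * Complex.log (1 - ζ ^ (j:ℕ))) := by
    apply baker
    · intro j
      apply IsAlgebraic.neg
      apply IsAlgebraic.mul
      · have := isAlgebraic_algebraMap (R := ℚ) (A := ℂ) (1/2^(k+1))
        simpa using this
      · apply alg_sum
        intro i _
        apply IsAlgebraic.mul
        · rcases fPer_cases (k+1) (m+i) with h | h <;> rw [h]
          · simpa using isAlgebraic_one
          · simpa using (isAlgebraic_one (R := ℚ) (A := ℂ)).neg
        · exact hζa.inv.pow _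
    · intro j
      by_cases h : 1 - ζ ^ (j:ℕ) = 0
      · rw [h]; simpa using isAlgebraic_one
      · rw [Complex.exp_log h]; exact isAlgebraic_one.sub (hζa.pow _)
    · have : ∑ j : Fin q, (- c j) * Complex.log (1 - ζ ^ (j:ℕ)) = (Lf k m : ℂ) := by
        rw [hF]; apply sum_congr rfl; intros; ring
      rw [this]
      exact_mod_cast Lf_ne_zero k m
  have h2 : ∑ j : Fin q, (- c j) * Complex.log (1 - ζ ^ (j:ℕ)) = (Lf k m : ℂ) := by
    rw [hF]; apply sum_congr rfl; intros; ring
  rw [h2] at h1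
  intro h
  exact h1 (h.algebraMap (A := ℂ))

theorem X_transc (k : ℕ) (x : ℝ) (hx : x ∈ Xset (k+1)) : Transcendental ℚ x := by
  obtain ⟨m, q, rfl⟩ := X_repr k x hx
  intro h
  apply Lf_transc k m
  have := h.sub (isAlgebraic_algebraMap (R := ℚ) (A := ℝ) q)
  simpa using this
end PartM

/-- Proposition 5 of the paper: each `X_k` (for `k ≥ 1`) is nonempty,
countable and contains no algebraic number; moreover the `X_k` are pairwise disjoint. -/
theorem stmt_18 :
    (∀ k : ℕ, 1 ≤ k →
      (Xset k).Nonempty ∧ (Xset k).Countable ∧ ∀ x ∈ Xset k, Transcendental ℚ x) ∧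
    (∀ k l : ℕ, 1 ≤ k → 1 ≤ l → k ≠ l → Xset k ∩ Xset l = ∅) := by
  constructor
  · intro k hk
    obtain ⟨k, rfl⟩ : ∃ j, k = j + 1 := ⟨k-1, by omega⟩
    exact ⟨X_nonempty k, X_countable k, X_transc k⟩
  · intro k l _ _ h
    rcases lt_or_gt_of_ne h with h | h
    · exact X_disj_lt k l h
    · rw [Set.inter_comm]; exact X_disj_lt l k h
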